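/- Let Ω ⊂ P(ℝ^d) be a properly convex domain, let Λ ⊂ Aut(Ω) be a convex co-compact subgroup, and let C = C_Ω(Λ). Assume every boundary face of Ω which intersects closure(C) has dimension at most one. If S₁, S₂ ⊂ C are distinct properly embedded two-dimensional simplices, then ∂S₁ ∩ ∂S₂ = ∅. -/

import Mathlib

open Set Filter

noncomputable section

/-- Real projective space `P(ℝ^d)`, with the quotient topology. -/
abbrev PSpace (d : ℕ) := Projectivization ℝ (Fin d → ℝ)

instance PSpace.instTopologicalSpace (d : ℕ) : TopologicalSpace (PSpace d) :=
  inferInstanceAs (TopologicalSpace (Quotient (projectivizationSetoid ℝ (Fin d → ℝ))))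

namespace Paper

variable {d : ℕ}

/-- Inhomogeneous coordinates in the affine chart determined by the linear functional `f`:
a projective point `[v]` with `f v ≠ 0` is sent to the representative `v / f v` lying in the
affine hyperplane `{f = 1}`. -/
def chartMap (f : (Fin d → ℝ) →ₗ[ℝ] ℝ) (x : PSpace d) : Fin d → ℝ :=
  (f x.rep)⁻¹ • x.rep

/-- A subset of `P(ℝ^d)` is properly convex if there is an affine chart in which it is a
bounded convex set. -/
def IsProperlyConvex (C : Set (PSpace d)) : Prop :=
  ∃ f : (Fin d → ℝ) →ₗ[ℝ] ℝ, (∀ x ∈ closure C, f x.rep ≠ 0) ∧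
    Convex ℝ (chartMap f '' C) ∧ Bornology.IsBounded (chartMap f '' C)

/-- A properly convex domain: an open, nonempty, properly convex subset of `P(ℝ^d)`. -/
def IsPCDomain (Ω : Set (PSpace d)) : Prop :=
  IsOpen Ω ∧ Ω.Nonempty ∧ IsProperlyConvex Ω

open Classical in
/-- A choice of an affine chart containing the properly convex set `C`. -/
def chartOf (C : Set (PSpace d)) : (Fin d → ℝ) →ₗ[ℝ] ℝ :=
  if h : IsProperlyConvex C then h.choose else 0

/-- The chart map associated to the chosen chart of `C`. -/
def cmap (C : Set (PSpace d)) : PSpace d → Fin d → ℝ := chartMap (chartOf C)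

/-- The Hilbert distance between `u` and `v` computed in an affine chart where the convex set
is `O`: writing the line through `u, v` as `t ↦ u + t(v-u)`, with boundary parameters
`tm = inf {t | u + t(v-u) ∈ O} ≤ 0` and `tp = sup {...} ≥ 1`, the cross-ratio
`[a,u,v,b]` of `a = u + tm(v-u), u, v, b = u + tp(v-u)` equals `(tp(1-tm))/((-tm)(tp-1))`. -/
def hilbertDistChart (O : Set (Fin d → ℝ)) (u v : Fin d → ℝ) : ℝ :=
  if u = v then 0
  else
    (1 / 2) * Real.log
      ((sSup {t : ℝ | u + t • (v - u) ∈ O} * (1 - sInf {t : ℝ | u + t • (v - u) ∈ O})) /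
        ((-(sInf {t : ℝ | u + t • (v - u) ∈ O})) * (sSup {t : ℝ | u + t • (v - u) ∈ O} - 1)))

/-- The Hilbert metric of a properly convex set `C` (open in its span). -/
def hilbertDist (C : Set (PSpace d)) (x y : PSpace d) : ℝ :=
  hilbertDistChart (cmap C '' C) (cmap C x) (cmap C y)

/-- The closed projective line segment `[x,y]` contained in `closure C`. -/
def projSeg (C : Set (PSpace d)) (x y : PSpace d) : Set (PSpace d) :=
  {z ∈ closure C | cmap C z ∈ segment ℝ (cmap C x) (cmap C y)}

/-- The open projective line segment `(x,y)` contained in `closure C`. -/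
def projOpenSeg (C : Set (PSpace d)) (x y : PSpace d) : Set (PSpace d) :=
  {z ∈ closure C | cmap C z ∈ openSegment ℝ (cmap C x) (cmap C y)}

/-- The open face `F_C(x)` of a point `x ∈ closure C`: the set `{x}` together with all
`y ∈ closure C` such that some open line segment contained in `closure C` contains
both `x` and `y`. -/
def face (C : Set (PSpace d)) (x : PSpace d) : Set (PSpace d) :=
  insert x {y ∈ closure C | ∃ a ∈ closure C, ∃ b ∈ closure C,
    x ∈ projOpenSeg C a b ∧ y ∈ projOpenSeg C a b}

/-- The ideal boundary `∂_i C = closure C \ C`. -/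
def idealBdry (C : Set (PSpace d)) : Set (PSpace d) := closure C \ C

/-- The dimension of a subset `B`, computed in the chart of the ambient convex set `C`. -/
def pdimIn (C B : Set (PSpace d)) : ℕ :=
  Module.finrank ℝ (affineSpan ℝ (cmap C '' B)).direction

/-- The dimension of a convex subset of `P(ℝ^d)`. -/
def pdim (A : Set (PSpace d)) : ℕ := pdimIn A A

/-- The coarse dimension `cdim_C(A)` of a nonempty subset `A` of a properly convex set `C`
open in its span: the smallest `k` such that `A` is contained in an `R`-neighborhood (for the
Hilbert metric of `C`) of a `k`-dimensional convex subset `B ⊆ C`. -/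
def cdim (C A : Set (PSpace d)) : ℕ :=
  sInf {k : ℕ | ∃ R : ℝ, 0 < R ∧ ∃ B : Set (PSpace d), B ⊆ C ∧
    Convex ℝ (cmap C '' B) ∧ pdimIn C B = k ∧
    A ⊆ {p ∈ C | ∃ q ∈ B, hilbertDist C p q < R}}

/-- The cone over the standard open `(p-1)`-dimensional simplex: vectors whose first `p`
coordinates are positive and whose remaining coordinates vanish. -/
def simplexCone (p : ℕ) : Set (Fin d → ℝ) :=
  {v | (∀ i : Fin d, (i : ℕ) < p → 0 < v i) ∧ ∀ i : Fin d, p ≤ (i : ℕ) → v i = 0}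

/-- `S` is the image under `g ∈ PGL_d(ℝ)` of the standard open simplex with `p` vertices. -/
def IsSimplexWithMap (p : ℕ) (S : Set (PSpace d)) (g : (Fin d → ℝ) ≃ₗ[ℝ] (Fin d → ℝ)) : Prop :=
  S = {q : PSpace d | ∃ v ∈ simplexCone (d := d) p, ∃ hv : v ≠ 0,
        q = Projectivization.mk ℝ (g v) (by simpa using hv)}

/-- `S ⊆ P(ℝ^d)` is a simplex of dimension `k`. -/
def IsSimplexOfDim (k : ℕ) (S : Set (PSpace d)) : Prop :=
  k + 1 ≤ d ∧ ∃ g : (Fin d → ℝ) ≃ₗ[ℝ] (Fin d → ℝ), IsSimplexWithMap (k + 1) S g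

/-- `S` is a simplex with vertices `v 0, …, v (p-1)` (so of dimension `p - 1`). -/
def HasVertices {p : ℕ} (S : Set (PSpace d)) (v : Fin p → PSpace d) : Prop :=
  ∃ (hp : p ≤ d) (g : (Fin d → ℝ) ≃ₗ[ℝ] (Fin d → ℝ)),
    IsSimplexWithMap p S g ∧
    ∀ j : Fin p, v j = Projectivization.mk ℝ (g (Pi.single (Fin.castLE hp j) 1))
      (by
        simp only [ne_eq, EmbeddingLike.map_eq_zero_iff]
        intro h
        have h1 := congrFun h (Fin.castLE hp j)
        rw [Pi.single_eq_same] at h1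
        exact one_ne_zero (α := ℝ) h1)

/-- `A ⊆ B` is properly embedded if the inclusion map `A ↪ B` is proper. -/
def IsProperlyEmbedded (A B : Set (PSpace d)) : Prop :=
  ∃ h : A ⊆ B, IsProperMap (Set.inclusion h)

/-- The projective action of `GL(ℝ^d)` (hence of `PGL_d(ℝ)`) on `P(ℝ^d)`. -/
def pact (g : (Fin d → ℝ) ≃ₗ[ℝ] (Fin d → ℝ)) : PSpace d → PSpace d :=
  Projectivization.map g.toLinearMap g.injective

/-- A naive convex co-compact triple `(Ω, C, Λ)`. -/
structure NCCTriple (d : ℕ) where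
  Ω : Set (PSpace d)
  C : Set (PSpace d)
  Λ : Subgroup ((Fin d → ℝ) ≃ₗ[ℝ] (Fin d → ℝ))
  isOpen_Ω : IsOpen Ω
  nonempty_Ω : Ω.Nonempty
  properlyConvex_Ω : IsProperlyConvex Ω
  inv_Ω : ∀ g ∈ Λ, pact g '' Ω = Ω
  infinite_Λ : (Λ : Set ((Fin d → ℝ) ≃ₗ[ℝ] (Fin d → ℝ))).Infinite
  discrete_Λ : ∀ K ⊆ Ω, IsCompact K →
    {g : (Fin d → ℝ) ≃ₗ[ℝ] (Fin d → ℝ) | g ∈ Λ ∧ (pact g '' K ∩ K).Nonempty}.Finite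
  C_nonempty : C.Nonempty
  C_sub : C ⊆ Ω
  C_closedInΩ : closure C ∩ Ω ⊆ C
  C_convex : Convex ℝ (cmap Ω '' C)
  inv_C : ∀ g ∈ Λ, pact g '' C = C
  cocompact : ∃ K : Set (PSpace d), K ⊆ C ∧ IsCompact K ∧ C ⊆ ⋃ g ∈ Λ, pact g '' K

/-- The orbit of a point under a subgroup of `PGL_d(ℝ)`. -/
def porbit (Λ : Subgroup ((Fin d → ℝ) ≃ₗ[ℝ] (Fin d → ℝ))) (p : PSpace d) : Set (PSpace d) :=
  {q | ∃ g ∈ Λ, q = pact g p}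

/-- The full orbital limit set `L_Ω(Λ)`. -/
def limitSet (Ω : Set (PSpace d)) (Λ : Subgroup ((Fin d → ℝ) ≃ₗ[ℝ] (Fin d → ℝ))) :
    Set (PSpace d) :=
  ⋃ p ∈ Ω, (closure (porbit Λ p) \ porbit Λ p)

/-- The convex hull of `X ⊆ closure Ω` taken inside `Ω`. -/
def convHullIn (Ω X : Set (PSpace d)) : Set (PSpace d) :=
  {z ∈ Ω | cmap Ω z ∈ convexHull ℝ (cmap Ω '' X)}

/-- `C_Ω(Λ)`: the convex hull of the full orbital limit set in `Ω`. -/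
def coreC (Ω : Set (PSpace d)) (Λ : Subgroup ((Fin d → ℝ) ≃ₗ[ℝ] (Fin d → ℝ))) :
    Set (PSpace d) :=
  convHullIn Ω (limitSet Ω Λ)

/-- A convex co-compact group `Λ ⊆ Aut(Ω)`: an infinite discrete subgroup preserving `Ω`
such that `C_Ω(Λ)` is nonempty and `Λ` acts cocompactly on it. -/
structure CCSetup (d : ℕ) where
  Ω : Set (PSpace d)
  Λ : Subgroup ((Fin d → ℝ) ≃ₗ[ℝ] (Fin d → ℝ))
  isOpen_Ω : IsOpen Ω
  nonempty_Ω : Ω.Nonempty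
  properlyConvex_Ω : IsProperlyConvex Ω
  inv_Ω : ∀ g ∈ Λ, pact g '' Ω = Ω
  infinite_Λ : (Λ : Set ((Fin d → ℝ) ≃ₗ[ℝ] (Fin d → ℝ))).Infinite
  discrete_Λ : ∀ K ⊆ Ω, IsCompact K →
    {g : (Fin d → ℝ) ≃ₗ[ℝ] (Fin d → ℝ) | g ∈ Λ ∧ (pact g '' K ∩ K).Nonempty}.Finite
  core_nonempty : (coreC Ω Λ).Nonempty
  cocompact : ∃ K : Set (PSpace d), K ⊆ coreC Ω Λ ∧ IsCompact K ∧
    coreC Ω Λ ⊆ ⋃ g ∈ Λ, pact g '' K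

/-- The Gromov product of `x, y` at `w`, with respect to the Hilbert metric of `Ω`. -/
def gromovProd (Ω : Set (PSpace d)) (w x y : PSpace d) : ℝ :=
  (hilbertDist Ω x w + hilbertDist Ω y w - hilbertDist Ω x y) / 2

/-- `(C, d_Ω)` is Gromov hyperbolic. -/
def GromovHyperbolicOn (Ω C : Set (PSpace d)) : Prop :=
  ∃ δ : ℝ, 0 ≤ δ ∧ ∀ x ∈ C, ∀ y ∈ C, ∀ z ∈ C, ∀ w ∈ C,
    min (gromovProd Ω w x y) (gromovProd Ω w y z) - δ ≤ gromovProd Ω w x z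

/-- The open Hilbert-metric ball in `Ω`. -/
def hBall (Ω : Set (PSpace d)) (x : PSpace d) (r : ℝ) : Set (PSpace d) :=
  {y ∈ Ω | hilbertDist Ω x y < r}

/-- The Hausdorff distance between `A` and `B` (w.r.t. the Hilbert metric of `Ω`)
is less than `ε`. -/
def hausLT (Ω A B : Set (PSpace d)) (ε : ℝ) : Prop :=
  (∀ a ∈ A, ∃ b ∈ B, hilbertDist Ω a b < ε) ∧ ∀ b ∈ B, ∃ a ∈ A, hilbertDist Ω a b < ε

/-- The Hausdorff distance between `A` and `B` (w.r.t. the Hilbert metric of `Ω`)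
is at most `r`. -/
def hausdorffDistLE (Ω A B : Set (PSpace d)) (r : ℝ) : Prop :=
  ∀ ε : ℝ, 0 < ε → hausLT Ω A B (r + ε)

/-- Convergence `F n → C` in the local Hausdorff topology induced by `d_Ω`. -/
def LocalHausConv (Ω : Set (PSpace d)) (F : ℕ → Set (PSpace d)) (C : Set (PSpace d)) : Prop :=
  ∀ x ∈ Ω, ∀ r : ℝ, 0 < r → ∀ ε : ℝ, 0 < ε →
    ∀ᶠ n in atTop, hausLT Ω (F n ∩ hBall Ω x r) (C ∩ hBall Ω x r) ε

/-- A collection `𝒮` of closed subsets of `Ω` is closed and discrete in the local Hausdorff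
topology: any sequence in `𝒮` converging to a nonempty closed subset of `Ω` has limit in `𝒮`
and is eventually equal to its limit. -/
def ClosedAndDiscreteInLHT (Ω : Set (PSpace d)) (𝒮 : Set (Set (PSpace d))) : Prop :=
  ∀ F : ℕ → Set (PSpace d), (∀ n, F n ∈ 𝒮) →
    ∀ C : Set (PSpace d), C.Nonempty → C ⊆ Ω → closure C ∩ Ω ⊆ C → LocalHausConv Ω F C →
      C ∈ 𝒮 ∧ ∀ᶠ n in atTop, F n = C


structure LSet (d : ℕ) where
  O : Set (Fin d → ℝ)
  D : Set (Fin d → ℝ)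
  f : (Fin d → ℝ) →ₗ[ℝ] ℝ
  R : ℝ
  isOpen : IsOpen O
  add_mem : ∀ u ∈ O, ∀ w ∈ O, u + w ∈ O
  smul_mem : ∀ t : ℝ, 0 < t → ∀ u ∈ O, t • u ∈ O
  f_pos : ∀ u ∈ O, 0 < f u
  norm_le : ∀ u ∈ O, ‖u‖ ≤ R * f u
  R_pos : 0 < R
  D_sub : D ⊆ O
  D_add : ∀ u ∈ D, ∀ w ∈ D, u + w ∈ D
  D_smul : ∀ t : ℝ, 0 < t → ∀ u ∈ D, t • u ∈ D
  H : ∀ x ∈ closure D, x ∉ O → x ≠ 0 → ∀ u₁ ∈ closure O, ∀ u₂ ∈ closure O, ∀ u₃ ∈ closure O,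
    ∀ M : ℝ, M • x - u₁ ∈ closure O → M • x - u₂ ∈ closure O → M • x - u₃ ∈ closure O →
    ¬ LinearIndependent ℝ ![u₁, u₂, u₃]
  G : ∃ K : Set (Fin d → ℝ), IsCompact K ∧ K ⊆ O ∧ ∀ p ∈ D,
    ∃ h : (Fin d → ℝ) ≃ₗ[ℝ] (Fin d → ℝ), (∀ u, h u ∈ O ↔ u ∈ O) ∧ (∀ u ∈ D, h u ∈ D) ∧ h p ∈ K

namespace LSet

variable (L : LSet d)

lemma fcont : Continuous L.f := LinearMap.continuous_of_finiteDimensional _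

lemma closure_add {X : Set (Fin d → ℝ)} (hX : ∀ u ∈ X, ∀ w ∈ X, u + w ∈ X) {u w : Fin d → ℝ}
    (hu : u ∈ closure X) (hw : w ∈ closure X) : u + w ∈ closure X :=
  map_mem_closure₂ continuous_add hu hw hX

lemma closure_smul {X : Set (Fin d → ℝ)} (hX : ∀ t : ℝ, 0 < t → ∀ u ∈ X, t • u ∈ X)
    {t : ℝ} (ht : 0 < t) {u : Fin d → ℝ}
    (hu : u ∈ closure X) : t • u ∈ closure X :=
  map_mem_closure (continuous_const_smul t) hu (fun u hu => hX t ht u hu)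

lemma K_add {u w : Fin d → ℝ} (hu : u ∈ closure L.O) (hw : w ∈ closure L.O) :
    u + w ∈ closure L.O := closure_add L.add_mem hu hw

lemma zero_mem {u : Fin d → ℝ} (hu : u ∈ closure L.O) : (0 : Fin d → ℝ) ∈ closure L.O := by
  have hc : Continuous (fun t : ℝ => t • u) := by fun_prop
  have h1 : Tendsto (fun t : ℝ => t • u) (nhdsWithin 0 (Ioi 0)) (nhds 0) := by
    have := (hc.tendsto 0).mono_left (nhdsWithin_le_nhds (s := Ioi 0))
    simpa using this
  refine isClosed_closure.mem_of_tendsto h1 ?_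
  filter_upwards [self_mem_nhdsWithin] with t ht
  exact closure_smul L.smul_mem ht hu

lemma K_smul {t : ℝ} (ht : 0 ≤ t) {u : Fin d → ℝ} (hu : u ∈ closure L.O) :
    t • u ∈ closure L.O := by
  rcases ht.eq_or_lt with rfl | ht
  · simpa using L.zero_mem hu
  · exact closure_smul L.smul_mem ht hu

lemma K_norm {u : Fin d → ℝ} (hu : u ∈ closure L.O) : ‖u‖ ≤ L.R * L.f u := by
  have hc : IsClosed {u : Fin d → ℝ | ‖u‖ ≤ L.R * L.f u} :=
    isClosed_le continuous_norm (continuous_const.mul L.fcont)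
  exact (closure_minimal (fun u hu => L.norm_le u hu) hc) hu

lemma K_f {u : Fin d → ℝ} (hu : u ∈ closure L.O) : 0 ≤ L.f u := by
  have := L.K_norm hu
  have h2 := norm_nonneg u
  have := L.R_pos
  by_contra hh
  push Not at hh
  nlinarith

lemma K_neg {u : Fin d → ℝ} (hu : u ∈ closure L.O) (hu' : -u ∈ closure L.O) : u = 0 := by
  have h1 := L.K_f hu
  have h2 := L.K_f hu'
  rw [map_neg] at h2
  have h3 : L.f u = 0 := by linarith
  have h4 := L.K_norm hu
  rw [h3, mul_zero] at h4
  exact norm_le_zero_iff.mp h4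

lemma zero_nmem : (0 : Fin d → ℝ) ∉ L.O := fun h => by
  have := L.f_pos 0 h
  simp at this

lemma O_add {u w : Fin d → ℝ} (hu : u ∈ L.O) (hw : w ∈ closure L.O) : u + w ∈ L.O := by
  have hc : Continuous (fun w' : Fin d → ℝ => u + (w - w')) := by fun_prop
  have ho : (fun w' : Fin d → ℝ => u + (w - w')) ⁻¹' L.O ∈ nhds w :=
    hc.continuousAt.preimage_mem_nhds (L.isOpen.mem_nhds (by simpa using hu))
  obtain ⟨w', h1, h2⟩ := mem_closure_iff_nhds.mp hw _ ho
  have := L.add_mem _ h1 _ h2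
  simpa [add_assoc] using this

/-- domination -/
lemma dom {x y : Fin d → ℝ} (hx : x ∈ L.O) {M : ℝ} (hM : 0 < M)
    (h : M • y - x ∈ closure L.O) : y ∈ L.O := by
  have h1 := L.O_add hx h
  have h2 := L.smul_mem M⁻¹ (by positivity) _ h1
  rw [add_sub_cancel, smul_smul, inv_mul_cancel₀ hM.ne', one_smul] at h2
  exact h2

lemma arch {x : Fin d → ℝ} (hx : x ∈ L.O) (u : Fin d → ℝ) : ∃ M : ℝ, 0 < M ∧ M • x - u ∈ L.O := by
  have hc : Continuous (fun t : ℝ => x - t • u) := by fun_prop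
  have ho : ∀ᶠ t in nhdsWithin (0 : ℝ) (Ioi 0), x - t • u ∈ L.O := by
    refine nhdsWithin_le_nhds (hc.continuousAt.preimage_mem_nhds (L.isOpen.mem_nhds ?_))
    simpa using hx
  obtain ⟨t, h1, h2⟩ := (ho.and self_mem_nhdsWithin).exists
  have ht : 0 < t := h2
  refine ⟨t⁻¹, by positivity, ?_⟩
  have h3 := L.smul_mem t⁻¹ (by positivity) _ h1
  rwa [smul_sub, smul_smul, inv_mul_cancel₀ ht.ne', one_smul] at h3

lemma sub_K : L.O ⊆ closure L.O := subset_closure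
lemma D_K : closure L.D ⊆ closure L.O := closure_mono L.D_sub

/-- boundary sums are scale independent -/
lemma scale_mem {u w : Fin d → ℝ} (hu : u ∈ closure L.O) (hw : w ∈ closure L.O)
    {s t : ℝ} (h : s • u + t • w ∈ L.O) : u + w ∈ L.O := by
  refine L.dom h (M := |s| + |t| + 1) (by positivity) ?_
  have e : (|s| + |t| + 1) • (u + w) - (s • u + t • w)
      = (|s| + |t| + 1 - s) • u + (|s| + |t| + 1 - t) • w := by module
  rw [e]
  have := le_abs_self s
  have := le_abs_self t
  have := abs_nonneg s
  have := abs_nonneg t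
  exact L.K_add (L.K_smul (by linarith) hu) (L.K_smul (by linarith) hw)

lemma lemE_aux {V A B A' : Fin d → ℝ} (hV : V ∈ closure L.O) (hA : A ∈ closure L.O)
    (hB : B ∈ closure L.O) (hA' : A' ∈ closure L.O) (hVB : V + B ∉ L.O) (hVAB : V + A + B ∈ L.O)
    {α β : ℝ} (h : A' = α • A + β • B) (h0 : A' ≠ 0) : 0 ≤ α := by
  by_contra hα
  push Not at hα
  by_cases hβ : β ≤ 0
  · apply h0
    apply L.K_neg hA'
    have e : -A' = (-α) • A + (-β) • B := by rw [h]; module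
    rw [e]
    exact L.K_add (L.K_smul (by linarith) hA) (L.K_smul (by linarith) hB)
  · push Not at hβ
    apply hVB
    have hs : 0 < β - α := by linarith
    refine L.dom hVAB (M := (β - α) / (-α)) (div_pos hs (by linarith)) ?_
    have e : ((β - α) / (-α)) • (V + B) - (V + A + B) = (β / (-α)) • V + (1 / (-α)) • A' := by
      rw [h]
      have hα' : -α ≠ 0 := by linarith
      have hα'' : α ≠ 0 := by linarith
      match_scalars <;> field_simp <;> ring
    rw [e]
    exact L.K_add (L.K_smul (div_nonneg hβ.le (by linarith)) hV)
      (L.K_smul (div_nonneg zero_le_one (by linarith)) hA')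

lemma lemE {V A B A' : Fin d → ℝ} (hV : V ∈ closure L.O) (hA : A ∈ closure L.O)
    (hB : B ∈ closure L.O) (hA' : A' ∈ closure L.O) (hVA : V + A ∉ L.O) (hVB : V + B ∉ L.O)
    (hVAB : V + A + B ∈ L.O)
    {α β : ℝ} (h : A' = α • A + β • B) (h0 : A' ≠ 0) : 0 ≤ α ∧ 0 ≤ β :=
  ⟨L.lemE_aux hV hA hB hA' hVB hVAB h h0,
   L.lemE_aux hV hB hA hA' hVA (by rwa [add_right_comm]) (by rw [h, add_comm]) h0⟩

lemma LI_pair_of_boundary {V A B : Fin d → ℝ} (hV : V ∈ closure L.O) (hA : A ∈ closure L.O)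
    (hB : B ∈ closure L.O) (hVA : V + A ∉ L.O) (hVB : V + B ∉ L.O)
    (hVAB : V + A + B ∈ L.O) : LinearIndependent ℝ ![A, B] := by
  have hA0 : A ≠ 0 := by
    rintro rfl
    exact hVB (by simpa using hVAB)
  rw [LinearIndependent.pair_iff' hA0]
  rintro c rfl
  apply hVA
  apply L.scale_mem hV hA (s := 1) (t := 1 + c)
  convert hVAB using 1
  module

lemma LI3_pair {a b c : Fin d → ℝ} (h : LinearIndependent ℝ ![a, b, c]) :
    LinearIndependent ℝ ![a, b] := by
  rw [LinearIndependent.pair_iff]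
  intro s t hst
  have := Fintype.linearIndependent_iff.mp h ![s, t, 0] (by simp [Fin.sum_univ_three, hst])
  exact ⟨by simpa using this 0, by simpa using this 1⟩

lemma LI3_swap {a b c : Fin d → ℝ} (h : LinearIndependent ℝ ![a, b, c]) :
    LinearIndependent ℝ ![b, a, c] := by
  rw [Fintype.linearIndependent_iff] at h ⊢
  intro g hg
  have := h ![g 1, g 0, g 2] (by
    rw [← hg]; simp [Fin.sum_univ_three]; abel)
  intro i
  fin_cases i
  · simpa using this 1
  · simpa using this 0
  · simpa using this 2

lemma LI3_rot {a b c : Fin d → ℝ} (h : LinearIndependent ℝ ![a, b, c]) :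
    LinearIndependent ℝ ![b, c, a] := by
  rw [Fintype.linearIndependent_iff] at h ⊢
  intro g hg
  have := h ![g 2, g 0, g 1] (by
    rw [← hg]; simp [Fin.sum_univ_three]; abel)
  intro i
  fin_cases i
  · simpa using this 1
  · simpa using this 2
  · simpa using this 0

lemma dep3 {a b c : Fin d → ℝ} (h : LinearIndependent ℝ ![a, b])
    (h' : ¬ LinearIndependent ℝ ![a, b, c]) : ∃ α β : ℝ, c = α • a + β • b := by
  by_contra hc
  push Not at hc
  apply h'
  rw [LinearIndependent.pair_iff] at h
  rw [Fintype.linearIndependent_iff]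
  intro g hg
  simp only [Fin.sum_univ_three, Matrix.cons_val] at hg
  have h2 : g 2 = 0 := by
    by_contra h2
    apply hc (-(g 2)⁻¹ * g 0) (-(g 2)⁻¹ * g 1)
    have e : c = (g 2)⁻¹ • (g 2 • c) := by rw [smul_smul, inv_mul_cancel₀ h2, one_smul]
    have e2 : g 2 • c = -(g 0 • a + g 1 • b) := (neg_eq_of_add_eq_zero_right hg).symm
    rw [e, e2]
    module
  rw [h2, zero_smul, add_zero] at hg
  obtain ⟨h0, h1⟩ := h _ _ hg
  intro i
  fin_cases i <;> assumption

lemma no3in2 {a b c x y : Fin d → ℝ} (h : LinearIndependent ℝ ![a, b, c])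
    (ha : a ∈ Submodule.span ℝ {x, y}) (hb : b ∈ Submodule.span ℝ {x, y})
    (hc : c ∈ Submodule.span ℝ {x, y}) : False := by
  have h1 := finrank_span_eq_card h
  have h2 : Submodule.span ℝ (Set.range ![a, b, c]) ≤ Submodule.span ℝ {x, y} := by
    rw [Submodule.span_le]
    rintro _ ⟨i, rfl⟩
    fin_cases i <;> assumption
  have h3 := Submodule.finrank_mono h2
  have h4 : Module.finrank ℝ (Submodule.span ℝ ({x, y} : Set (Fin d → ℝ))) ≤ 2 := by
    classical
    have := finrank_span_finset_le_card (R := ℝ) ({x, y} : Finset (Fin d → ℝ))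
    have h5 := Finset.card_le_two (a := x) (b := y)
    have h6 : ((({x, y} : Finset (Fin d → ℝ)) : Set (Fin d → ℝ))) = {x, y} := by simp
    rw [h6, Set.finrank] at this
    omega
  simp at h1
  omega

structure Tri (v a b : Fin d → ℝ) : Prop where
  li : LinearIndependent ℝ ![v, a, b]
  int : ∀ x y z : ℝ, 0 < x → 0 < y → 0 < z → x • v + y • a + z • b ∈ L.D
  va : v + a ∉ L.O
  vb : v + b ∉ L.O
  ab : a + b ∉ L.O

variable {L}

lemma Tri.swap {v a b : Fin d → ℝ} (T : L.Tri v a b) : L.Tri a v b where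
  li := LI3_swap T.li
  int x y z hx hy hz := by
    have := T.int y x z hy hx hz
    rwa [add_comm (y • v)] at this
  va := by rw [add_comm]; exact T.va
  vb := T.ab
  ab := T.vb

lemma Tri.rot {v a b : Fin d → ℝ} (T : L.Tri v a b) : L.Tri a b v where
  li := LI3_rot T.li
  int x y z hx hy hz := by
    have := T.int z x y hz hx hy
    convert this using 1; abel
  va := T.ab
  vb := by rw [add_comm]; exact T.va
  ab := by rw [add_comm]; exact T.vb

lemma Tri.memD {v a b : Fin d → ℝ} (T : L.Tri v a b) {x y z : ℝ} (hx : 0 ≤ x) (hy : 0 ≤ y)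
    (hz : 0 ≤ z) : x • v + y • a + z • b ∈ closure L.D := by
  have hc : Continuous (fun t : ℝ => (x + t) • v + (y + t) • a + (z + t) • b) := by fun_prop
  have h1 : Tendsto (fun t : ℝ => (x + t) • v + (y + t) • a + (z + t) • b)
      (nhdsWithin 0 (Ioi 0)) (nhds (x • v + y • a + z • b)) := by
    have := (hc.tendsto 0).mono_left (nhdsWithin_le_nhds (s := Ioi 0))
    simpa using this
  refine mem_closure_of_tendsto h1 ?_
  filter_upwards [self_mem_nhdsWithin] with t ht
  have ht : 0 < t := ht
  exact T.int _ _ _ (by linarith) (by linarith) (by linarith)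

lemma Tri.vD {v a b : Fin d → ℝ} (T : L.Tri v a b) : v ∈ closure L.D := by
  simpa using T.memD zero_le_one le_rfl le_rfl

lemma Tri.vK {v a b : Fin d → ℝ} (T : L.Tri v a b) : v ∈ closure L.O := L.D_K T.vD

lemma Tri.v0 {v a b : Fin d → ℝ} (T : L.Tri v a b) : v ≠ 0 := T.li.ne_zero 0

lemma Tri.sumO {v a b : Fin d → ℝ} (T : L.Tri v a b) : v + a + b ∈ L.O := by
  simpa using L.D_sub (T.int 1 1 1 one_pos one_pos one_pos)

lemma Tri.scale {v a b : Fin d → ℝ} (T : L.Tri v a b) {c : ℝ} (hc : 0 < c) :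
    L.Tri (c • v) a b where
  li := by
    have h := T.li
    rw [Fintype.linearIndependent_iff] at h ⊢
    intro g hg
    have := h ![g 0 * c, g 1, g 2] (by
      rw [← hg]; simp [Fin.sum_univ_three, smul_smul])
    intro i
    fin_cases i
    · simpa [hc.ne'] using this 0
    · simpa using this 1
    · simpa using this 2
  int x y z hx hy hz := by
    rw [smul_smul]
    exact T.int _ _ _ (by positivity) hy hz
  va := fun h => T.va (L.scale_mem T.vK T.rot.vK (s := c) (t := 1) (by simpa using h))
  vb := fun h => T.vb (L.scale_mem T.vK T.rot.rot.vK (s := c) (t := 1) (by simpa using h))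
  ab := T.ab

lemma Tri.sum_ne {v a b : Fin d → ℝ} (T : L.Tri v a b) : v + a ≠ 0 := fun h => by
  have := Fintype.linearIndependent_iff.mp T.li ![1, 1, 0] (by simp [Fin.sum_univ_three, h]) 0
  simp at this

/-- vertex of one triangle is not interior to a segment -/
lemma lemF_aux {v a b w₁ w₂ : Fin d → ℝ} (T : L.Tri v a b) (h₁ : w₁ ∈ closure L.O)
    (h₂ : w₂ ∈ closure L.O) (hli : LinearIndependent ℝ ![w₁, w₂]) {s t : ℝ} (hs : 0 < s)
    (ht : 0 < t) (h : v = s • w₁ + t • w₂) : a ∈ Submodule.span ℝ {w₁, w₂} := by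
  have hd := L.H (v + a) (by simpa using T.memD zero_le_one zero_le_one le_rfl) T.va T.sum_ne
    w₁ h₁ w₂ h₂ a T.rot.vK (s⁻¹ + t⁻¹ + 1) ?_ ?_ ?_
  · obtain ⟨α, β, e⟩ := dep3 hli hd
    exact Submodule.mem_span_pair.mpr ⟨α, β, e.symm⟩
  · have e : (s⁻¹ + t⁻¹ + 1) • (v + a) - w₁
        = (t⁻¹ * s + s) • w₁ + ((s⁻¹ + t⁻¹ + 1) * t) • w₂ + (s⁻¹ + t⁻¹ + 1) • a := by
      rw [h]; match_scalars <;> field_simp <;> ring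
    rw [e]
    exact L.K_add (L.K_add (L.K_smul (by positivity) h₁) (L.K_smul (by positivity) h₂))
      (L.K_smul (by positivity) T.rot.vK)
  · have e : (s⁻¹ + t⁻¹ + 1) • (v + a) - w₂
        = ((s⁻¹ + t⁻¹ + 1) * s) • w₁ + (s⁻¹ * t + t) • w₂ + (s⁻¹ + t⁻¹ + 1) • a := by
      rw [h]; match_scalars <;> field_simp <;> ring
    rw [e]
    exact L.K_add (L.K_add (L.K_smul (by positivity) h₁) (L.K_smul (by positivity) h₂))
      (L.K_smul (by positivity) T.rot.vK)
  · have e : (s⁻¹ + t⁻¹ + 1) • (v + a) - a = (s⁻¹ + t⁻¹ + 1) • v + (s⁻¹ + t⁻¹) • a := by module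
    rw [e]
    exact L.K_add (L.K_smul (by positivity) T.vK) (L.K_smul (by positivity) T.rot.vK)

lemma lemF {v a b w₁ w₂ : Fin d → ℝ} (T : L.Tri v a b) (h₁ : w₁ ∈ closure L.O)
    (h₂ : w₂ ∈ closure L.O) (hli : LinearIndependent ℝ ![w₁, w₂]) {s t : ℝ} (hs : 0 < s)
    (ht : 0 < t) (h : v = s • w₁ + t • w₂) : False :=
  no3in2 T.li (Submodule.mem_span_pair.mpr ⟨s, t, h.symm⟩) (lemF_aux T h₁ h₂ hli hs ht h)
    (lemF_aux T.rot.rot.swap h₁ h₂ hli hs ht h)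

/-- the limiting argument -/
lemma limit_data {v a b a' b' : Fin d → ℝ} (T : L.Tri v a b) (T' : L.Tri v a' b') :
    ∃ V A B A' B' : Fin d → ℝ, V ∈ closure L.D ∧ A ∈ closure L.D ∧ B ∈ closure L.D ∧
      A' ∈ closure L.D ∧ B' ∈ closure L.D ∧ V + A + B ∈ L.O ∧ V + A ∉ L.O ∧ V + B ∉ L.O ∧
      A + B ∉ L.O ∧ V + A' ∉ L.O ∧ V + B' ∉ L.O ∧
      (∀ x y z y' z' : ℝ, x • v + y • a + z • b + y' • a' + z' • b' ∈ closure L.O →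
        y • A + z • B + y' • A' + z' • B' ∈ closure L.O) := by
  obtain ⟨K, hK, hKO, hKD⟩ := L.G
  have hε : ∀ n : ℕ, 0 < (1 / ((n : ℝ) + 1)) := fun n => by positivity
  have hp : ∀ n : ℕ, v + (1 / ((n : ℝ) + 1)) • a + (1 / ((n : ℝ) + 1)) • b ∈ L.D := fun n => by
    simpa using T.int 1 _ _ one_pos (hε n) (hε n)
  choose h hO hD hhK using fun n => hKD _ (hp n)
  set ε : ℕ → ℝ := fun n => 1 / ((n : ℝ) + 1) with hεdef
  have hεlim : Tendsto ε atTop (nhds 0) := tendsto_one_div_add_atTop_nhds_zero_nat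
  -- closure invariance
  have hcD : ∀ n, ∀ u ∈ closure L.D, h n u ∈ closure L.D := fun n u hu =>
    map_mem_closure (LinearMap.continuous_of_finiteDimensional (h n).toLinearMap) hu
      (fun u hu => hD n u hu)
  have hcO : ∀ n, ∀ u ∈ closure L.O, h n u ∈ closure L.O := fun n u hu =>
    map_mem_closure (LinearMap.continuous_of_finiteDimensional (h n).toLinearMap) hu
      (fun u hu => (hO n u).mpr hu)
  have hhK' : ∀ n, h n v + ε n • h n a + ε n • h n b ∈ K := fun n => by
    have := hhK n
    rw [map_add, map_add, map_smul, map_smul] at this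
    exact this
  obtain ⟨B0, hB0⟩ := (hK.image L.fcont).isBounded.bddAbove
  have hB0' : ∀ n, L.f (h n v) + ε n * L.f (h n a) + ε n * L.f (h n b) ≤ B0 := fun n => by
    have := hB0 (mem_image_of_mem L.f (hhK' n))
    rw [map_add, map_add, map_smul, map_smul] at this
    exact this
  have fpos : ∀ n, ∀ u ∈ closure L.D, 0 ≤ L.f (h n u) := fun n u hu => L.K_f (L.D_K (hcD n u hu))
  have hε1 : ∀ n, ε n ≤ 1 := fun n => by
    simp only [hεdef]
    rw [div_le_one (by positivity)]
    have : (0 : ℝ) ≤ n := by positivity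
    linarith
  -- existence of limits
  have hex : ∀ (w : ℕ → (Fin d → ℝ)) (Q : ℝ), (∀ n, w n ∈ closure L.D) → (∀ n, L.f (w n) ≤ Q) →
      ∃ W ∈ closure L.D, Tendsto w (hyperfilter ℕ : Filter ℕ) (nhds W) := by
    intro w Q hw hQ
    have hc : IsCompact (Metric.closedBall (0 : Fin d → ℝ) (L.R * Q)) := isCompact_closedBall _ _
    have hm : ∀ n, w n ∈ Metric.closedBall (0 : Fin d → ℝ) (L.R * Q) := fun n => by
      rw [mem_closedBall_zero_iff]
      exact (L.K_norm (L.D_K (hw n))).trans (mul_le_mul_of_nonneg_left (hQ n) L.R_pos.le)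
    obtain ⟨W, -, hW⟩ := hc.ultrafilter_le_nhds ((hyperfilter ℕ).map w)
      (by
        rw [le_principal_iff]
        exact Filter.mem_map.mpr (Filter.Eventually.of_forall hm))
    exact ⟨W, isClosed_closure.mem_of_tendsto hW (Filter.Eventually.of_forall hw), hW⟩
  have hsm : ∀ n, ∀ u ∈ closure L.D, ε n • h n u ∈ closure L.D := fun n u hu =>
    closure_smul L.D_smul (hε n) (hcD n u hu)
  have hv := T.vD
  have ha := T.rot.vD
  have hb := T.rot.rot.vD
  have ha' := T'.rot.vD
  have hb' := T'.rot.rot.vD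
  have nn : ∀ n, ∀ u ∈ closure L.D, 0 ≤ ε n * L.f (h n u) := fun n u hu =>
    mul_nonneg (hε n).le (fpos n u hu)
  obtain ⟨V, hVD, hV⟩ := hex (fun n => h n v) B0 (fun n => hcD n v hv) (fun n => by
    have := hB0' n; have := nn n a ha; have := nn n b hb; linarith)
  obtain ⟨A, hAD, hA⟩ := hex (fun n => ε n • h n a) B0 (fun n => hsm n a ha) (fun n => by
    rw [map_smul, smul_eq_mul]
    have := hB0' n; have := fpos n v hv; have := nn n b hb; linarith)
  obtain ⟨B, hBD, hB⟩ := hex (fun n => ε n • h n b) B0 (fun n => hsm n b hb) (fun n => by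
    rw [map_smul, smul_eq_mul]
    have := hB0' n; have := fpos n v hv; have := nn n a ha; linarith)
  have hbd : ∀ u ∈ closure L.D, ∃ Q, ∀ n, L.f (ε n • h n u) ≤ Q := by
    intro u hu
    obtain ⟨M, hM, hMu⟩ := L.arch T.sumO u
    refine ⟨M * B0, fun n => ?_⟩
    have h1 := L.K_f (hcO n _ (L.sub_K hMu))
    simp only [map_sub, map_smul, map_add, smul_eq_mul] at h1 ⊢
    have h2 := mul_le_mul_of_nonneg_left (hB0' n) hM.le
    have h3 := mul_nonneg (hε n).le h1
    have h4 := mul_nonneg hM.le (mul_nonneg (sub_nonneg.mpr (hε1 n)) (fpos n v hv))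
    have h5 : ε n * (M * (L.f (h n v) + L.f (h n a) + L.f (h n b)) - L.f (h n u)) =
      ε n * M * L.f (h n v) + ε n * M * L.f (h n a) + ε n * M * L.f (h n b) - ε n * L.f (h n u) := by
      ring
    change 0 ≤ ε n * (M * (L.f (h n v) + L.f (h n a) + L.f (h n b)) - L.f (h n u)) at h3
    rw [h5] at h3
    linarith
  obtain ⟨Qa, hQa⟩ := hbd a' ha'
  obtain ⟨Qb, hQb⟩ := hbd b' hb'
  obtain ⟨A', hAD', hA'⟩ := hex (fun n => ε n • h n a') Qa (fun n => hsm n a' ha') hQa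
  obtain ⟨B', hBD', hB'⟩ := hex (fun n => ε n • h n b') Qb (fun n => hsm n b' hb') hQb
  have hcl : IsClosed (L.Oᶜ) := L.isOpen.isClosed_compl
  have key : ∀ u ∈ closure L.O, v + u ∉ L.O → v ∈ closure L.O → ∀ n, h n v + ε n • h n u ∈ L.Oᶜ := by
    intro u hu hvu hv n hmem
    apply hvu
    have : h n (v + ε n • u) ∈ L.O := by simpa using hmem
    rw [hO] at this
    exact L.scale_mem hv hu (s := 1) (t := ε n) (by simpa using this)
  have hle : (hyperfilter ℕ : Filter ℕ) ≤ atTop := by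
    rw [← Nat.cofinite_eq_atTop]; exact hyperfilter_le_cofinite
  refine ⟨V, A, B, A', B', hVD, hAD, hBD, hAD', hBD', ?_, ?_, ?_, ?_, ?_, ?_, ?_⟩
  · refine hKO (hK.isClosed.mem_of_tendsto ((hV.add hA).add hB) (Filter.Eventually.of_forall ?_))
    exact hhK'
  · exact hcl.mem_of_tendsto (hV.add hA) (Filter.Eventually.of_forall
      (key a (L.D_K ha) T.va (L.D_K hv)))
  · exact hcl.mem_of_tendsto (hV.add hB) (Filter.Eventually.of_forall
      (key b (L.D_K hb) T.vb (L.D_K hv)))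
  · refine hcl.mem_of_tendsto (hA.add hB) (Filter.Eventually.of_forall ?_)
    intro n hmem
    apply T.ab
    have : h n (ε n • a + ε n • b) ∈ L.O := by simpa using hmem
    rw [hO] at this
    exact L.scale_mem (L.D_K ha) (L.D_K hb) this
  · exact hcl.mem_of_tendsto (hV.add hA') (Filter.Eventually.of_forall
      (key a' (L.D_K ha') T'.va (L.D_K hv)))
  · exact hcl.mem_of_tendsto (hV.add hB') (Filter.Eventually.of_forall
      (key b' (L.D_K hb') T'.vb (L.D_K hv)))
  · intro x y z y' z' hmem
    have h0 : Tendsto (fun n => ε n • (x • h n v)) (hyperfilter ℕ : Filter ℕ) (nhds 0) := by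
      have := (hεlim.mono_left hle).smul (hV.const_smul x)
      simpa using this
    have hlim := (((h0.add (hA.const_smul y)).add (hB.const_smul z)).add
      (hA'.const_smul y')).add (hB'.const_smul z')
    rw [zero_add] at hlim
    refine isClosed_closure.mem_of_tendsto hlim (Filter.Eventually.of_forall ?_)
    intro n
    have := L.K_smul (hε n).le (hcO n _ hmem)
    convert this using 1
    simp only [map_add, map_smul]
    change _ = ε n • _
    module

lemma match_vertices {v a b a' b' : Fin d → ℝ} (T : L.Tri v a b) (T' : L.Tri v a' b') :
    (v + a + a' ∉ L.O ∧ v + b + b' ∉ L.O) ∨ (v + a + b' ∉ L.O ∧ v + b + a' ∉ L.O) := by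
  obtain ⟨V, A, B, A', B', hV, hA, hB, hA', hB', hVAB, hVA, hVB, hAB, hVA', hVB', hlim⟩ :=
    limit_data T T'
  replace hV := L.D_K hV
  have hABD := closure_add L.D_add hA hB
  replace hA := L.D_K hA
  replace hB := L.D_K hB
  replace hA' := L.D_K hA'
  replace hB' := L.D_K hB'
  have hAB0 : A + B ≠ 0 := by
    intro h0
    rw [add_assoc, h0, add_zero] at hVAB
    exact hVA (L.O_add hVAB hA)
  have hli := L.LI_pair_of_boundary hV hA hB hVA hVB hVAB
  obtain ⟨M, hM, hMu⟩ := L.arch T.sumO (a' + b')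
  obtain ⟨M', hM', hMu'⟩ := L.arch T'.sumO (a + b)
  have d1 : M • (A + B) - (A' + B') ∈ closure L.O := by
    have := hlim M M M (-1) (-1) (by convert L.sub_K hMu using 1; module)
    convert this using 1; module
  have d2 : M' • (A' + B') - (A + B) ∈ closure L.O := by
    have := hlim M' (-1) (-1) M' M' (by convert L.sub_K hMu' using 1; module)
    convert this using 1; module
  have hVAB' : V + A' + B' ∈ L.O := by
    refine L.dom hVAB (M := M' + 1) (by positivity) ?_
    have e : (M' + 1) • (V + A' + B') - (V + A + B)
      = M' • V + A' + B' + (M' • (A' + B') - (A + B)) := by module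
    rw [e]
    exact L.K_add (L.K_add (L.K_add (L.K_smul hM'.le hV) hA') hB') d2
  have hA0 : A' ≠ 0 := by
    rintro rfl
    exact hVB' (by simpa using hVAB')
  have hB0 : B' ≠ 0 := by
    rintro rfl
    exact hVA' (by simpa using hVAB')
  -- any X among A', B'
  have hpar : ∀ X ∈ closure L.O, X ≠ 0 → M • (A + B) - X ∈ closure L.O → V + X ∉ L.O →
      (∃ α : ℝ, 0 < α ∧ X = α • A) ∨ (∃ β : ℝ, 0 < β ∧ X = β • B) := by
    intro X hX hX0 hXd hVX
    have hd := L.H (A + B) hABD hAB hAB0 A hA B hB X hX (M + 1) ?_ ?_ ?_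
    · obtain ⟨α, β, e⟩ := dep3 hli hd
      obtain ⟨h1, h2⟩ := L.lemE hV hA hB hX hVA hVB hVAB e hX0
      rcases h1.eq_or_lt with h1 | h1
      · right
        subst h1
        rcases h2.eq_or_lt with h2 | h2
        · subst h2; exact absurd (by simpa using e) hX0
        · exact ⟨β, h2, by simpa using e⟩
      · rcases h2.eq_or_lt with h2 | h2
        · left
          subst h2; exact ⟨α, h1, by simpa using e⟩
        · exfalso
          apply hVX
          refine L.dom hVAB (M := 1 + α⁻¹ + β⁻¹) (by positivity) ?_
          have e2 : (1 + α⁻¹ + β⁻¹) • (V + X) - (V + A + B)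
              = (α⁻¹ + β⁻¹) • V + (α + β⁻¹ * α) • A + (β + α⁻¹ * β) • B := by
            rw [e]; match_scalars <;> field_simp <;> ring
          rw [e2]
          exact L.K_add (L.K_add (L.K_smul (by positivity) hV) (L.K_smul (by positivity) hA))
            (L.K_smul (by positivity) hB)
    · have e : (M + 1) • (A + B) - A = M • A + (M + 1) • B := by module
      rw [e]; exact L.K_add (L.K_smul hM.le hA) (L.K_smul (by positivity) hB)
    · have e : (M + 1) • (A + B) - B = (M + 1) • A + M • B := by module
      rw [e]; exact L.K_add (L.K_smul (by positivity) hA) (L.K_smul hM.le hB)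
    · have e : (M + 1) • (A + B) - X = A + B + (M • (A + B) - X) := by module
      rw [e]; exact L.K_add (L.K_add hA hB) hXd
  have pA := hpar A' hA' hA0 (by
    have e : M • (A + B) - A' = M • (A + B) - (A' + B') + B' := by abel
    rw [e]; exact L.K_add d1 hB') hVA'
  have pB := hpar B' hB' hB0 (by
    have e : M • (A + B) - B' = M • (A + B) - (A' + B') + A' := by abel
    rw [e]; exact L.K_add d1 hA') hVB'
  -- conclusions
  have fin1 : ∀ P Q : Fin d → ℝ, P ∈ closure L.O → V + P + Q ∈ L.O → V + P ∉ L.O →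
      ∀ N : ℝ, N • P - Q ∈ closure L.O → False := by
    intro P Q hP hPQ hVP N hN
    apply hVP
    apply L.scale_mem hV hP (s := 1) (t := 1 + N)
    have := L.O_add hPQ hN
    convert this using 1
    module
  have hVBA : V + B + A ∈ L.O := by rwa [add_right_comm]
  rcases pA with ⟨α, hα, eA⟩ | ⟨α, hα, eA⟩ <;> rcases pB with ⟨β, hβ, eB⟩ | ⟨β, hβ, eB⟩
  · exfalso
    apply hVA
    apply L.scale_mem hV hA (s := 1) (t := α + β)
    rw [eA, eB] at hVAB'
    convert hVAB' using 1
    module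
  · left
    constructor
    · intro hmem
      obtain ⟨N, hN, hNu⟩ := L.arch hmem b
      have := hlim N N (-1) N 0 (by convert L.sub_K hNu using 1; module)
      refine fin1 A B hA hVAB hVA (N + N * α) ?_
      rw [eA] at this
      convert this using 1
      module
    · intro hmem
      obtain ⟨N, hN, hNu⟩ := L.arch hmem a
      have := hlim N (-1) N 0 N (by convert L.sub_K hNu using 1; module)
      refine fin1 B A hB hVBA hVB (N + N * β) ?_
      rw [eB] at this
      convert this using 1
      module
  · right
    constructor
    · intro hmem
      obtain ⟨N, hN, hNu⟩ := L.arch hmem b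
      have := hlim N N (-1) 0 N (by convert L.sub_K hNu using 1; module)
      refine fin1 A B hA hVAB hVA (N + N * β) ?_
      rw [eB] at this
      convert this using 1
      module
    · intro hmem
      obtain ⟨N, hN, hNu⟩ := L.arch hmem a
      have := hlim N (-1) N N 0 (by convert L.sub_K hNu using 1; module)
      refine fin1 B A hB hVBA hVB (N + N * α) ?_
      rw [eA] at this
      convert this using 1
      module
  · exfalso
    apply hVB
    apply L.scale_mem hV hB (s := 1) (t := α + β)
    rw [eA, eB] at hVAB'
    convert hVAB' using 1
    module

lemma same_vertex {v a b a' b' : Fin d → ℝ} (T : L.Tri v a b) (T' : L.Tri v a' b')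
    (h : v + a + a' ∉ L.O) : ∃ c : ℝ, 0 < c ∧ a' = c • a := by
  have hxD : v + a + a' ∈ closure L.D :=
    closure_add L.D_add (closure_add L.D_add T.vD T.rot.vD) T'.rot.vD
  have hv := T.vK
  have ha := T.rot.vK
  have ha' := T'.rot.vK
  have hx0 : v + a + a' ≠ 0 := by
    intro h0
    apply T.v0
    apply L.K_neg hv
    have e : -v = a + a' := by
      rw [add_assoc] at h0
      exact neg_eq_of_add_eq_zero_right h0
    rw [e]; exact L.K_add ha ha'
  have hd := L.H _ hxD h hx0 v hv a ha a' ha' 1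
    (by have e : (1 : ℝ) • (v + a + a') - v = a + a' := by module
        rw [e]; exact L.K_add ha ha')
    (by have e : (1 : ℝ) • (v + a + a') - a = v + a' := by module
        rw [e]; exact L.K_add hv ha')
    (by have e : (1 : ℝ) • (v + a + a') - a' = v + a := by module
        rw [e]; exact L.K_add hv ha)
  obtain ⟨α, β, e⟩ := dep3 (LI3_pair T.li) hd
  have hb := T.rot.rot
  obtain ⟨h1, h2⟩ := L.lemE hb.vK hv ha ha' hb.va hb.vb hb.sumO e T'.rot.v0
  have hβ : 0 < β := by
    rcases h2.eq_or_lt with h2 | h2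
    · exfalso
      subst h2
      have := (LinearIndependent.pair_iff' T.v0).mp (LI3_pair T'.li) α
      exact this (by simpa using e.symm)
    · exact h2
  rcases h1.eq_or_lt with h1 | h1
  · subst h1
    exact ⟨β, hβ, by simpa using e⟩
  · exact (lemF T'.rot hv ha (LI3_pair T.li) h1 hβ e).elim

def coneSet (v a b : Fin d → ℝ) : Set (Fin d → ℝ) :=
  {u | ∃ x y z : ℝ, 0 < x ∧ 0 < y ∧ 0 < z ∧ u = x • v + y • a + z • b}

lemma coneSet_rot (v a b : Fin d → ℝ) : coneSet a b v = coneSet v a b := by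
  ext u
  constructor
  · rintro ⟨x, y, z, hx, hy, hz, rfl⟩
    exact ⟨z, x, y, hz, hx, hy, by abel⟩
  · rintro ⟨x, y, z, hx, hy, hz, rfl⟩
    exact ⟨y, z, x, hy, hz, hx, by abel⟩

lemma coneSet_swap (v a b : Fin d → ℝ) : coneSet a v b = coneSet v a b := by
  ext u
  constructor
  · rintro ⟨x, y, z, hx, hy, hz, rfl⟩
    exact ⟨y, x, z, hy, hx, hz, by abel⟩
  · rintro ⟨x, y, z, hx, hy, hz, rfl⟩
    exact ⟨y, x, z, hy, hx, hz, by abel⟩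

lemma coneSet_scale (v a b : Fin d → ℝ) {c : ℝ} (hc : 0 < c) :
    coneSet (c • v) a b = coneSet v a b := by
  ext u
  constructor
  · rintro ⟨x, y, z, hx, hy, hz, rfl⟩
    exact ⟨x * c, y, z, by positivity, hy, hz, by module⟩
  · rintro ⟨x, y, z, hx, hy, hz, rfl⟩
    exact ⟨x / c, y, z, by positivity, hy, hz, by rw [smul_smul, div_mul_cancel₀ _ hc.ne']⟩

lemma same_cone {v a b a' b' : Fin d → ℝ} (T : L.Tri v a b) (T' : L.Tri v a' b') :
    coneSet v a b = coneSet v a' b' := by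
  have hT : L.Tri v b a := T.rot.rot.swap
  have hT' : L.Tri v b' a' := T'.rot.rot.swap
  have aux : ∀ (a b : Fin d → ℝ) {c e : ℝ}, 0 < c → 0 < e →
      coneSet v (c • a) (e • b) = coneSet v a b := by
    intro a b c e hc he
    rw [← coneSet_rot, coneSet_scale _ _ _ hc, ← coneSet_rot, coneSet_scale _ _ _ he,
      ← coneSet_rot]
  rcases match_vertices T T' with ⟨h1, h2⟩ | ⟨h1, h2⟩
  · obtain ⟨c, hc, rfl⟩ := same_vertex T T' h1
    obtain ⟨e, he, rfl⟩ := same_vertex hT hT' h2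
    exact (aux a b hc he).symm
  · obtain ⟨c, hc, rfl⟩ := same_vertex T hT' h1
    obtain ⟨e, he, rfl⟩ := same_vertex hT T' h2
    rw [aux b a he hc, ← coneSet_rot v b a, coneSet_swap, coneSet_rot, ← coneSet_rot,
      ← coneSet_rot]

/-- common vertex up to scale -/
lemma same_cone' {v a b v' a' b' : Fin d → ℝ} (T : L.Tri v a b) (T' : L.Tri v' a' b') {c : ℝ}
    (hc : 0 < c) (h : v' = c • v) : coneSet v a b = coneSet v' a' b' := by
  subst h
  rw [coneSet_scale _ _ _ hc]
  have := T'.scale (inv_pos.mpr hc)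
  rw [smul_smul, inv_mul_cancel₀ hc.ne', one_smul] at this
  exact same_cone T this

/-- a vertex of the second triangle lies in the span of an edge of the first -/
lemma edge_cone {v a b v' a' b' : Fin d → ℝ} (T : L.Tri v a b) (T' : L.Tri v' a' b') {α β : ℝ}
    (h : v' = α • v + β • a) : coneSet v a b = coneSet v' a' b' := by
  have hb := T.rot.rot
  obtain ⟨h1, h2⟩ := L.lemE hb.vK T.vK T.rot.vK T'.vK hb.va hb.vb hb.sumO h T'.v0
  rcases h1.eq_or_lt with h1 | h1
  · subst h1
    rcases h2.eq_or_lt with h2 | h2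
    · subst h2
      exact absurd (by simpa using h) T'.v0
    · rw [← coneSet_rot]
      exact same_cone' T.rot T' h2 (by simpa using h)
  · rcases h2.eq_or_lt with h2 | h2
    · subst h2
      exact same_cone' T T' h1 (by simpa using h)
    · exact (lemF T' T.vK T.rot.vK (LI3_pair T.li) h1 h2 h).elim

lemma main_edges {v a b v' a' b' x : Fin d → ℝ} (T : L.Tri v a b) (T' : L.Tri v' a' b')
    {s t s' t' : ℝ} (hs : 0 ≤ s) (ht : 0 ≤ t) (hs' : 0 ≤ s') (ht' : 0 ≤ t') (hx0 : x ≠ 0)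
    (h : x = s • v + t • a) (h' : x = s' • v' + t' • a') :
    coneSet v a b = coneSet v' a' b' := by
  rcases hs'.eq_or_lt with hs'0 | hs'0
  · subst hs'0
    have ht0 : t' ≠ 0 := by
      rintro rfl; exact hx0 (by simpa using h')
    rw [← coneSet_rot v' a' b']
    refine edge_cone T T'.rot (α := t'⁻¹ * s) (β := t'⁻¹ * t) ?_
    have e : a' = t'⁻¹ • x := by
      rw [h', zero_smul, zero_add, smul_smul, inv_mul_cancel₀ ht0, one_smul]
    rw [e, h]; module
  rcases ht'.eq_or_lt with ht'0 | ht'0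
  · subst ht'0
    refine edge_cone T T' (α := s'⁻¹ * s) (β := s'⁻¹ * t) ?_
    have e : v' = s'⁻¹ • x := by
      rw [h', zero_smul, add_zero, smul_smul, inv_mul_cancel₀ hs'0.ne', one_smul]
    rw [e, h]; module
  rcases hs.eq_or_lt with hs0 | hs0
  · subst hs0
    have ht0 : t ≠ 0 := by
      rintro rfl; exact hx0 (by simpa using h)
    rw [← coneSet_rot v a b]
    refine (edge_cone T' T.rot (α := t⁻¹ * s') (β := t⁻¹ * t') ?_).symm
    have e : a = t⁻¹ • x := by
      rw [h, zero_smul, zero_add, smul_smul, inv_mul_cancel₀ ht0, one_smul]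
    rw [e, h']; module
  rcases ht.eq_or_lt with ht0 | ht0
  · subst ht0
    refine (edge_cone T' T (α := s⁻¹ * s') (β := s⁻¹ * t') ?_).symm
    have e : v = s⁻¹ • x := by
      rw [h, zero_smul, add_zero, smul_smul, inv_mul_cancel₀ hs0.ne', one_smul]
    rw [e, h']; module
  have hxD : x ∈ closure L.D := by
    have := T.memD hs ht le_rfl
    rw [h]; simpa using this
  have hxO : x ∉ L.O := fun hx => T.va (L.scale_mem T.vK T.rot.vK (h ▸ hx))
  have hd := L.H x hxD hxO hx0 v T.vK a T.rot.vK v' T'.vK (s⁻¹ + t⁻¹ + s'⁻¹) ?_ ?_ ?_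
  · obtain ⟨α, β, e⟩ := dep3 (LI3_pair T.li) hd
    exact edge_cone T T' e
  · have e : (s⁻¹ + t⁻¹ + s'⁻¹) • x - v
        = (t⁻¹ * s + s'⁻¹ * s) • v + ((s⁻¹ + t⁻¹ + s'⁻¹) * t) • a := by
      rw [h]; match_scalars <;> field_simp <;> ring
    rw [e]
    exact L.K_add (L.K_smul (by positivity) T.vK) (L.K_smul (by positivity) T.rot.vK)
  · have e : (s⁻¹ + t⁻¹ + s'⁻¹) • x - a
        = ((s⁻¹ + t⁻¹ + s'⁻¹) * s) • v + (s⁻¹ * t + s'⁻¹ * t) • a := by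
      rw [h]; match_scalars <;> field_simp <;> ring
    rw [e]
    exact L.K_add (L.K_smul (by positivity) T.vK) (L.K_smul (by positivity) T.rot.vK)
  · have e : (s⁻¹ + t⁻¹ + s'⁻¹) • x - v'
        = (s⁻¹ * s' + t⁻¹ * s') • v' + ((s⁻¹ + t⁻¹ + s'⁻¹) * t') • a' := by
      rw [h']; match_scalars <;> field_simp <;> ring
    rw [e]
    exact L.K_add (L.K_smul (by positivity) T'.vK) (L.K_smul (by positivity) T'.rot.vK)

lemma reduce {v a b x : Fin d → ℝ} (T : L.Tri v a b) {r s t : ℝ} (hr : 0 ≤ r) (hs : 0 ≤ s)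
    (ht : 0 ≤ t) (h : x = r • v + s • a + t • b) (hn : ¬ (0 < r ∧ 0 < s ∧ 0 < t)) :
    ∃ v₁ a₁ b₁ : Fin d → ℝ, L.Tri v₁ a₁ b₁ ∧ coneSet v₁ a₁ b₁ = coneSet v a b ∧
      ∃ s₁ t₁ : ℝ, 0 ≤ s₁ ∧ 0 ≤ t₁ ∧ x = s₁ • v₁ + t₁ • a₁ := by
  rcases hr.eq_or_lt with hr0 | hr0
  · subst hr0
    exact ⟨a, b, v, T.rot, coneSet_rot _ _ _, s, t, hs, ht, by simpa using h⟩
  rcases hs.eq_or_lt with hs0 | hs0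
  · subst hs0
    exact ⟨b, v, a, T.rot.rot, by rw [← coneSet_rot, ← coneSet_rot], t, r, ht, hr,
      by rw [add_comm]; simpa using h⟩
  rcases ht.eq_or_lt with ht0 | ht0
  · subst ht0
    exact ⟨v, a, b, T, rfl, r, s, hr, hs, by simpa using h⟩
  exact absurd ⟨hr0, hs0, ht0⟩ hn

theorem linear_main {v a b v' a' b' x : Fin d → ℝ} (T : L.Tri v a b) (T' : L.Tri v' a' b')
    {r s t r' s' t' : ℝ} (hr : 0 ≤ r) (hs : 0 ≤ s) (ht : 0 ≤ t) (hr' : 0 ≤ r') (hs' : 0 ≤ s')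
    (ht' : 0 ≤ t') (hx0 : x ≠ 0)
    (h : x = r • v + s • a + t • b) (h' : x = r' • v' + s' • a' + t' • b')
    (hn : ¬ (0 < r ∧ 0 < s ∧ 0 < t)) (hn' : ¬ (0 < r' ∧ 0 < s' ∧ 0 < t')) :
    coneSet v a b = coneSet v' a' b' := by
  obtain ⟨_, _, _, T1, e1, _, _, h1, h2, h3⟩ := reduce T hr hs ht h hn
  obtain ⟨_, _, _, T2, e2, _, _, h4, h5, h6⟩ := reduce T' hr' hs' ht' h' hn'
  rw [← e1, ← e2]
  exact main_edges T1 T2 h1 h2 h4 h5 hx0 h3 h6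

end LSet

/-- quotient map -/
def qmap (d : ℕ) : {v : Fin d → ℝ // v ≠ 0} → PSpace d := fun v => Projectivization.mk ℝ v.1 v.2

lemma qmap_quot : Topology.IsQuotientMap (qmap d) := isQuotientMap_quot_mk

lemma isOpen_vec {W : Set (PSpace d)} (hW : IsOpen W) :
    IsOpen {u : Fin d → ℝ | ∃ h : u ≠ 0, Projectivization.mk ℝ u h ∈ W} := by
  have h1 : IsOpen (qmap d ⁻¹' W) := hW.preimage qmap_quot.continuous
  have h2 : IsOpen {u : Fin d → ℝ | u ≠ 0} := isOpen_ne
  have h3 := h2.isOpenMap_subtype_val _ h1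
  convert h3 using 1
  ext u
  constructor
  · rintro ⟨h, hu⟩
    exact ⟨⟨u, h⟩, hu, rfl⟩
  · rintro ⟨⟨u, h⟩, hu, rfl⟩
    exact ⟨h, hu⟩

lemma isOpen_proj {U : Set (Fin d → ℝ)} (hU : IsOpen U) :
    IsOpen {x : PSpace d | ∃ u ∈ U, ∃ h : u ≠ 0, x = Projectivization.mk ℝ u h} := by
  rw [← qmap_quot.isOpen_preimage]
  have e : qmap d ⁻¹' {x : PSpace d | ∃ u ∈ U, ∃ h : u ≠ 0, x = Projectivization.mk ℝ u h}
      = ⋃ t : ℝˣ, (fun v : {v : Fin d → ℝ // v ≠ 0} => t • v.1) ⁻¹' U := by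
    ext ⟨v, hv⟩
    simp only [mem_preimage, Set.mem_ofPred_eq, mem_iUnion, qmap]
    constructor
    · rintro ⟨u, hu, h, e⟩
      rw [eq_comm, Projectivization.mk_eq_mk_iff] at e
      obtain ⟨a, ha⟩ := e
      exact ⟨a, by rw [ha]; exact hu⟩
    · rintro ⟨t, ht⟩
      refine ⟨_, ht, by simpa [Units.smul_def] using hv, ?_⟩
      rw [eq_comm, Projectivization.mk_eq_mk_iff]
      exact ⟨t, rfl⟩
  rw [e]
  exact isOpen_iUnion fun t => hU.preimage
    ((continuous_const_smul (t : ℝ)).comp continuous_subtype_val)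

lemma chartMap_mk (f : (Fin d → ℝ) →ₗ[ℝ] ℝ) (v : Fin d → ℝ) (hv : v ≠ 0) :
    chartMap f (Projectivization.mk ℝ v hv) = (f v)⁻¹ • v := by
  obtain ⟨a, ha⟩ := Projectivization.exists_smul_eq_mk_rep ℝ v hv
  rw [chartMap, ← ha, Units.smul_def, map_smul, smul_eq_mul, mul_inv, smul_smul]
  congr 1
  rw [mul_comm, ← mul_assoc, mul_inv_cancel₀ a.ne_zero, one_mul]

lemma f_rep_iff (f : (Fin d → ℝ) →ₗ[ℝ] ℝ) (v : Fin d → ℝ) (hv : v ≠ 0) :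
    f (Projectivization.mk ℝ v hv).rep ≠ 0 ↔ f v ≠ 0 := by
  obtain ⟨a, ha⟩ := Projectivization.exists_smul_eq_mk_rep ℝ v hv
  rw [← ha, Units.smul_def, map_smul, smul_eq_mul]
  simp

lemma mk_smul_eq {v : Fin d → ℝ} (hv : v ≠ 0) {c : ℝ} (hc : c ≠ 0) (h : c • v ≠ 0) :
    Projectivization.mk ℝ (c • v) h = Projectivization.mk ℝ v hv := by
  rw [Projectivization.mk_eq_mk_iff']
  exact ⟨c, rfl⟩

lemma mk_congr {u v : Fin d → ℝ} (h : u = v) (hu : u ≠ 0) (hv : v ≠ 0) :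
    Projectivization.mk ℝ u hu = Projectivization.mk ℝ v hv := by
  subst h; rfl

lemma f_chartMap (f : (Fin d → ℝ) →ₗ[ℝ] ℝ) (x : PSpace d) (h : f x.rep ≠ 0) :
    f (chartMap f x) = 1 := by
  simp [chartMap, h]

lemma chartMap_ne (f : (Fin d → ℝ) →ₗ[ℝ] ℝ) (x : PSpace d) (h : f x.rep ≠ 0) :
    chartMap f x ≠ 0 := by
  intro h0
  have := f_chartMap f x h
  rw [h0] at this
  simp at this

lemma mk_chartMap (f : (Fin d → ℝ) →ₗ[ℝ] ℝ) (x : PSpace d) (h : f x.rep ≠ 0) :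
    Projectivization.mk ℝ (chartMap f x) (chartMap_ne f x h) = x := by
  conv_rhs => rw [← x.mk_rep]
  exact mk_smul_eq x.rep_nonzero (inv_ne_zero h) _

lemma chartMap_continuousOn (f : (Fin d → ℝ) →ₗ[ℝ] ℝ) {X : Set (PSpace d)}
    (hX : ∀ x ∈ X, f x.rep ≠ 0) : ContinuousOn (chartMap f) X := by
  have fc : Continuous f := LinearMap.continuous_of_finiteDimensional f
  intro x hx
  apply ContinuousAt.continuousWithinAt
  rw [continuousAt_def]
  intro N hN
  obtain ⟨N', hN', hN'o, hxN⟩ := mem_nhds_iff.mp hN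
  have hU : IsOpen ({w : Fin d → ℝ | f w ≠ 0} ∩ (fun w => (f w)⁻¹ • w) ⁻¹' N') := by
    apply ContinuousOn.isOpen_inter_preimage _ (isOpen_ne_fun fc continuous_const) hN'o
    exact (fc.continuousOn.inv₀ (fun w hw => hw)).smul continuousOn_id
  refine mem_of_superset ((isOpen_proj hU).mem_nhds ?_) ?_
  · refine ⟨x.rep, ⟨hX x hx, hxN⟩, x.rep_nonzero, x.mk_rep.symm⟩
  · rintro _ ⟨w, ⟨hw1, hw2⟩, h, rfl⟩
    rw [mem_preimage, chartMap_mk]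
    exact hN' hw2

/-- The lift of `X` to the half-space `f > 0`. -/
def lift (f : (Fin d → ℝ) →ₗ[ℝ] ℝ) (X : Set (PSpace d)) : Set (Fin d → ℝ) :=
  {u | 0 < f u ∧ ∃ h : u ≠ 0, Projectivization.mk ℝ u h ∈ X}

lemma ne_of_f {f : (Fin d → ℝ) →ₗ[ℝ] ℝ} {u : Fin d → ℝ} (h : 0 < f u) : u ≠ 0 := by
  rintro rfl; simp at h

lemma lift_isOpen (f : (Fin d → ℝ) →ₗ[ℝ] ℝ) {X : Set (PSpace d)} (hX : IsOpen X) :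
    IsOpen (lift f X) :=
  (isOpen_lt continuous_const (LinearMap.continuous_of_finiteDimensional f)).inter (isOpen_vec hX)

lemma lift_mono (f : (Fin d → ℝ) →ₗ[ℝ] ℝ) {X Y : Set (PSpace d)} (h : X ⊆ Y) :
    lift f X ⊆ lift f Y := fun _ ⟨h1, h2, h3⟩ => ⟨h1, h2, h h3⟩

lemma lift_smul (f : (Fin d → ℝ) →ₗ[ℝ] ℝ) {X : Set (PSpace d)} {t : ℝ} (ht : 0 < t)
    {u : Fin d → ℝ} (hu : u ∈ lift f X) : t • u ∈ lift f X := by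
  obtain ⟨h1, h2, h3⟩ := hu
  have h4 : 0 < f (t • u) := by simpa using mul_pos ht h1
  exact ⟨h4, ne_of_f h4, by rwa [mk_smul_eq h2 ht.ne']⟩

lemma mem_lift_iff (f : (Fin d → ℝ) →ₗ[ℝ] ℝ) {X : Set (PSpace d)} (hX : ∀ x ∈ X, f x.rep ≠ 0)
    (u : Fin d → ℝ) : u ∈ lift f X ↔ 0 < f u ∧ (f u)⁻¹ • u ∈ chartMap f '' X := by
  constructor
  · rintro ⟨h1, h2, h3⟩
    exact ⟨h1, _, h3, chartMap_mk f u h2⟩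
  · rintro ⟨h1, x, hx, e⟩
    refine ⟨h1, ne_of_f h1, ?_⟩
    have : Projectivization.mk ℝ u (ne_of_f h1) = x := by
      rw [← mk_chartMap f x (hX x hx)]
      have h0 : (f u)⁻¹ • u ≠ 0 := smul_ne_zero (inv_ne_zero h1.ne') (ne_of_f h1)
      rw [mk_congr e _ h0, mk_smul_eq (ne_of_f h1) (inv_ne_zero h1.ne')]
    rwa [this]

lemma mk_mem_closure (f : (Fin d → ℝ) →ₗ[ℝ] ℝ) {X : Set (PSpace d)} {u : Fin d → ℝ}
    (hu : u ∈ closure (lift f X)) (h : u ≠ 0) : Projectivization.mk ℝ u h ∈ closure X := by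
  rw [mem_closure_iff]
  intro W hW hm
  obtain ⟨w, ⟨h1, h2⟩, h3, h4, h5⟩ := mem_closure_iff.mp hu _ (isOpen_vec hW) ⟨h, hm⟩
  exact ⟨_, h2, h5⟩

lemma mem_closure_lift (f : (Fin d → ℝ) →ₗ[ℝ] ℝ) {X : Set (PSpace d)} {u : Fin d → ℝ}
    (hu : 0 < f u) (h : Projectivization.mk ℝ u (ne_of_f hu) ∈ closure X) :
    u ∈ closure (lift f X) := by
  rw [mem_closure_iff]
  intro U hU hm
  have hU' : IsOpen (U ∩ {w | 0 < f w}) :=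
    hU.inter (isOpen_lt continuous_const (LinearMap.continuous_of_finiteDimensional f))
  obtain ⟨_, ⟨w, ⟨h1, h2⟩, h3, rfl⟩, h4⟩ :=
    mem_closure_iff.mp h _ (isOpen_proj hU') ⟨u, ⟨hm, hu⟩, ne_of_f hu, rfl⟩
  exact ⟨w, h1, h2, h3, h4⟩

lemma chartMap_mem_closure_lift (f : (Fin d → ℝ) →ₗ[ℝ] ℝ) {X : Set (PSpace d)} {x : PSpace d}
    (hf : f x.rep ≠ 0) (h : x ∈ closure X) : chartMap f x ∈ closure (lift f X) := by
  apply mem_closure_lift f (by rw [f_chartMap f x hf]; exact one_pos)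
  rwa [mk_chartMap f x hf]

lemma isCompact_proj {N : Set (Fin d → ℝ)} (hN : IsCompact N) (h0 : (0 : Fin d → ℝ) ∉ N) :
    IsCompact {x : PSpace d | ∃ u ∈ N, ∃ h : u ≠ 0, x = Projectivization.mk ℝ u h} := by
  have h1 : IsCompact ((↑) ⁻¹' N : Set {v : Fin d → ℝ // v ≠ 0}) := by
    apply Topology.IsInducing.subtypeVal.isCompact_preimage' hN
    intro u hu
    exact ⟨⟨u, fun h => h0 (h ▸ hu)⟩, rfl⟩
  convert h1.image (qmap_quot (d := d)).continuous using 1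
  ext x
  constructor
  · rintro ⟨u, hu, h, rfl⟩
    exact ⟨⟨u, h⟩, hu, rfl⟩
  · rintro ⟨⟨u, h⟩, hu, rfl⟩
    exact ⟨u, hu, h, rfl⟩

lemma pact_mk (g : (Fin d → ℝ) ≃ₗ[ℝ] (Fin d → ℝ)) (v : Fin d → ℝ) (hv : v ≠ 0) (h : g v ≠ 0) :
    pact g (Projectivization.mk ℝ v hv) = Projectivization.mk ℝ (g v) h := rfl

lemma pact_continuous (g : (Fin d → ℝ) ≃ₗ[ℝ] (Fin d → ℝ)) : Continuous (pact g) := by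
  rw [(qmap_quot (d := d)).continuous_iff]
  have gc : Continuous g := LinearMap.continuous_of_finiteDimensional g.toLinearMap
  have : pact g ∘ qmap d = qmap d ∘ fun v => ⟨g v.1, by simpa using v.2⟩ := rfl
  rw [this]
  exact qmap_quot.continuous.comp ((gc.comp continuous_subtype_val).subtype_mk _)

lemma pact_mul (g h : (Fin d → ℝ) ≃ₗ[ℝ] (Fin d → ℝ)) (x : PSpace d) :
    pact (g * h) x = pact g (pact h x) := by
  induction x using Projectivization.ind with
  | h v hv => rfl

lemma pact_one (x : PSpace d) : pact (1 : (Fin d → ℝ) ≃ₗ[ℝ] (Fin d → ℝ)) x = x := by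
  induction x using Projectivization.ind with
  | h v hv => rfl

lemma pact_inv (g : (Fin d → ℝ) ≃ₗ[ℝ] (Fin d → ℝ)) (x : PSpace d) :
    pact g⁻¹ (pact g x) = x := by
  rw [← pact_mul, inv_mul_cancel, pact_one]

lemma pact_inv' (g : (Fin d → ℝ) ≃ₗ[ℝ] (Fin d → ℝ)) (x : PSpace d) :
    pact g (pact g⁻¹ x) = x := by
  rw [← pact_mul, mul_inv_cancel, pact_one]

/-- sign lemma -/
lemma exists_sign {X : Set (Fin d → ℝ)} (hX : ∀ u ∈ X, ∀ w ∈ X, ∀ s t : ℝ, 0 < s → 0 < t →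
      s • u + t • w ∈ X) (φ : (Fin d → ℝ) →ₗ[ℝ] ℝ) (hφ : ∀ u ∈ X, φ u ≠ 0) :
    ∃ s : ℝ, s ≠ 0 ∧ ∀ u ∈ X, 0 < s * φ u := by
  by_cases h : ∀ u ∈ X, 0 < φ u
  · exact ⟨1, one_ne_zero, fun u hu => by simpa using h u hu⟩
  · push Not at h
    obtain ⟨u, hu, h1⟩ := h
    have h1 := lt_of_le_of_ne h1 (hφ u hu)
    refine ⟨-1, by norm_num, fun w hw => ?_⟩
    by_contra hc
    have h2 : 0 < φ w := lt_of_le_of_ne (by linarith) (hφ w hw).symm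
    apply hφ _ (hX u hu w hw (φ w) (-φ u) h2 (by linarith))
    simp; ring

/-- normalized sums -/
lemma normalized_add {f : (Fin d → ℝ) →ₗ[ℝ] ℝ} {u w : Fin d → ℝ} (hu : 0 < f u) (hw : 0 < f w) :
    ∃ s t : ℝ, 0 < s ∧ 0 < t ∧ s + t = 1 ∧
      (f (u + w))⁻¹ • (u + w) = s • ((f u)⁻¹ • u) + t • ((f w)⁻¹ • w) := by
  refine ⟨f u / (f u + f w), f w / (f u + f w), by positivity, by positivity, by field_simp, ?_⟩
  rw [map_add]
  match_scalars <;> field_simp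

section CC
variable (T : CCSetup d)

lemma chart_spec : (∀ x ∈ closure T.Ω, chartOf T.Ω x.rep ≠ 0) ∧
    Convex ℝ (chartMap (chartOf T.Ω) '' T.Ω) ∧
    Bornology.IsBounded (chartMap (chartOf T.Ω) '' T.Ω) := by
  have h : chartOf T.Ω = T.properlyConvex_Ω.choose := by
    rw [chartOf, dif_pos T.properlyConvex_Ω]
  rw [h]
  exact T.properlyConvex_Ω.choose_spec

lemma rep_ne {x : PSpace d} (hx : x ∈ closure T.Ω) : chartOf T.Ω x.rep ≠ 0 :=
  (chart_spec T).1 x hx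

lemma rep_ne' : ∀ x ∈ T.Ω, chartOf T.Ω x.rep ≠ 0 := fun _ hx => rep_ne T (subset_closure hx)

/-- the open cone over Ω -/
def OO : Set (Fin d → ℝ) := lift (chartOf T.Ω) T.Ω
/-- the cone over the core -/
def DD : Set (Fin d → ℝ) := lift (chartOf T.Ω) (coreC T.Ω T.Λ)

lemma core_sub : coreC T.Ω T.Λ ⊆ T.Ω := fun _ h => h.1

lemma DD_sub : DD T ⊆ OO T := lift_mono _ (core_sub T)

lemma OO_add : ∀ u ∈ OO T, ∀ w ∈ OO T, u + w ∈ OO T := by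
  intro u hu w hw
  rw [OO, mem_lift_iff _ (rep_ne' T)] at hu hw ⊢
  refine ⟨by rw [map_add]; exact add_pos hu.1 hw.1, ?_⟩
  obtain ⟨s, t, hs, ht, hst, e⟩ := normalized_add hu.1 hw.1
  rw [e]
  exact (chart_spec T).2.1 hu.2 hw.2 hs.le ht.le hst

lemma OO_smul : ∀ t : ℝ, 0 < t → ∀ u ∈ OO T, t • u ∈ OO T := fun _ ht _ hu => lift_smul _ ht hu

lemma DD_smul : ∀ t : ℝ, 0 < t → ∀ u ∈ DD T, t • u ∈ DD T := fun _ ht _ hu => lift_smul _ ht hu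

lemma mem_DD (u : Fin d → ℝ) : u ∈ DD T ↔ u ∈ OO T ∧
    (chartOf T.Ω u)⁻¹ • u ∈ convexHull ℝ (cmap T.Ω '' limitSet T.Ω T.Λ) := by
  constructor
  · rintro ⟨h1, h2, h3, h4⟩
    rw [cmap, chartMap_mk] at h4
    exact ⟨⟨h1, h2, h3⟩, h4⟩
  · rintro ⟨⟨h1, h2, h3⟩, h4⟩
    refine ⟨h1, h2, h3, ?_⟩
    rw [cmap, chartMap_mk]
    exact h4

lemma DD_add : ∀ u ∈ DD T, ∀ w ∈ DD T, u + w ∈ DD T := by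
  intro u hu w hw
  rw [mem_DD] at hu hw ⊢
  refine ⟨OO_add T _ hu.1 _ hw.1, ?_⟩
  obtain ⟨s, t, hs, ht, hst, e⟩ := normalized_add hu.1.1 hw.1.1
  rw [e]
  exact convex_convexHull ℝ _ hu.2 hw.2 hs.le ht.le hst

lemma OO_norm : ∃ R : ℝ, 0 < R ∧ ∀ u ∈ OO T, ‖u‖ ≤ R * chartOf T.Ω u := by
  obtain ⟨R, hR⟩ := (chart_spec T).2.2.exists_norm_le
  refine ⟨max R 1, by positivity, fun u hu => ?_⟩
  rw [OO, mem_lift_iff _ (rep_ne' T)] at hu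
  have h1 := hR _ hu.2
  rw [norm_smul, Real.norm_eq_abs, abs_of_pos (inv_pos.mpr hu.1)] at h1
  have h2 : ‖u‖ ≤ R * chartOf T.Ω u := by
    rw [inv_mul_le_iff₀ hu.1] at h1; linarith
  exact h2.trans (mul_le_mul_of_nonneg_right (le_max_left _ _) hu.1.le)

lemma f_pos_closure {u : Fin d → ℝ} (hu : u ∈ closure (OO T)) (h0 : u ≠ 0) :
    0 < chartOf T.Ω u := by
  obtain ⟨R, hR, h⟩ := OO_norm T
  have hc : IsClosed {u : Fin d → ℝ | ‖u‖ ≤ R * chartOf T.Ω u} :=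
    isClosed_le continuous_norm
      (continuous_const.mul (LinearMap.continuous_of_finiteDimensional _))
  have h1 : ‖u‖ ≤ R * chartOf T.Ω u := (closure_minimal h hc) hu
  have h2 := norm_pos_iff.mpr h0
  exact pos_of_mul_pos_right (h2.trans_le h1) hR.le

lemma OO_nonzero_closure_add {u w : Fin d → ℝ} (hu : u ∈ closure (OO T))
    (hw : w ∈ closure (OO T)) : u + w ∈ closure (OO T) :=
  LSet.closure_add (OO_add T) hu hw

lemma pact_Ω {g} (hg : g ∈ T.Λ) {x : PSpace d} : pact g x ∈ T.Ω ↔ x ∈ T.Ω := by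
  constructor
  · intro h
    rw [← T.inv_Ω g hg] at h
    obtain ⟨y, hy, e⟩ := h
    rw [← pact_inv g x, ← e, pact_inv]
    exact hy
  · intro h
    rw [← T.inv_Ω g hg]
    exact ⟨x, h, rfl⟩

lemma pact_orbit {g} (hg : g ∈ T.Λ) {p x : PSpace d} :
    pact g x ∈ porbit T.Λ p ↔ x ∈ porbit T.Λ p := by
  constructor
  · rintro ⟨h, hh, e⟩
    refine ⟨g⁻¹ * h, T.Λ.mul_mem (T.Λ.inv_mem hg) hh, ?_⟩
    rw [pact_mul, ← e, pact_inv]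
  · rintro ⟨h, hh, rfl⟩
    exact ⟨g * h, T.Λ.mul_mem hg hh, (pact_mul _ _ _).symm⟩

lemma pact_limit {g} (hg : g ∈ T.Λ) {x : PSpace d} (hx : x ∈ limitSet T.Ω T.Λ) :
    pact g x ∈ limitSet T.Ω T.Λ := by
  simp only [limitSet, mem_iUnion] at hx ⊢
  obtain ⟨p, hp, h1, h2⟩ := hx
  refine ⟨p, hp, ?_, fun h => h2 ((pact_orbit T hg).mp h)⟩
  exact map_mem_closure (pact_continuous g) h1 (fun y hy => (pact_orbit T hg).mpr hy)

lemma limit_sub {x : PSpace d} (hx : x ∈ limitSet T.Ω T.Λ) : x ∈ closure T.Ω := by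
  simp only [limitSet, mem_iUnion] at hx
  obtain ⟨p, hp, h1, h2⟩ := hx
  refine closure_mono ?_ h1
  rintro _ ⟨g, hg, rfl⟩
  exact (pact_Ω T hg).mpr hp

/-- linear lift of an element of `Λ` -/
lemma exists_lift {g} (hg : g ∈ T.Λ) : ∃ h : (Fin d → ℝ) ≃ₗ[ℝ] (Fin d → ℝ),
    (∀ u, h u ∈ OO T ↔ u ∈ OO T) ∧ (∀ u ∈ DD T, h u ∈ DD T) ∧ ∃ c : ℝ, c ≠ 0 ∧ ∀ u, h u = c • g u := by
  obtain ⟨s, hs, hsp⟩ := exists_sign (X := OO T)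
    (fun u hu w hw s t hs ht => OO_add T _ (OO_smul T s hs u hu) _ (OO_smul T t ht w hw))
    ((chartOf T.Ω).comp g.toLinearMap) (by
      intro u hu
      obtain ⟨h1, h2, h3⟩ := hu
      have h4 : g u ≠ 0 := by simpa using h2
      have h5 := rep_ne' T _ ((pact_Ω T hg).mpr h3)
      rw [pact_mk g u h2 h4, f_rep_iff] at h5
      exact h5)
  let h : (Fin d → ℝ) ≃ₗ[ℝ] (Fin d → ℝ) := g.trans (LinearEquiv.smulOfNeZero ℝ _ s hs)
  have hh : ∀ u, h u = s • g u := fun u => rfl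
  have hmk : ∀ u (hu : u ≠ 0) (hu' : h u ≠ 0),
      Projectivization.mk ℝ (h u) hu' = pact g (Projectivization.mk ℝ u hu) := by
    intro u hu hu'
    have h4 : g u ≠ 0 := by simpa using hu
    rw [pact_mk g u hu h4]
    exact mk_smul_eq h4 hs hu'
  have hO : ∀ u ∈ OO T, h u ∈ OO T := by
    intro u hu
    have h1 : 0 < chartOf T.Ω (h u) := by simpa [hh] using hsp u hu
    refine ⟨h1, ne_of_f h1, ?_⟩
    rw [hmk u hu.2.1]
    exact (pact_Ω T hg).mpr hu.2.2
  refine ⟨h, fun u => ⟨fun hu => ?_, hO u⟩, fun u hu => ?_, s, hs, hh⟩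
  · obtain ⟨h1, h2, h3⟩ := hu
    have hu0 : u ≠ 0 := by
      rintro rfl; simp at h2
    rw [hmk u hu0, pact_Ω T hg] at h3
    have h4 := rep_ne' T _ h3
    rw [f_rep_iff] at h4
    by_contra hn
    have h5 : chartOf T.Ω u < 0 := by
      by_contra h6
      exact hn ⟨lt_of_le_of_ne (not_lt.mp h6) h4.symm, hu0, h3⟩
    have h7 : -u ∈ OO T := by
      refine ⟨by simpa using h5, by simpa using hu0, ?_⟩
      rw [mk_congr (neg_one_smul ℝ u).symm _ (by simpa using hu0), mk_smul_eq hu0 (by norm_num)]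
      exact h3
    have h8 := (hO _ h7).1
    rw [map_neg, map_neg] at h8
    linarith
  · rw [mem_DD] at hu ⊢
    refine ⟨hO u hu.1, ?_⟩
    set f := chartOf T.Ω with hf
    -- the convex set of good points
    have hcO : ∀ u ∈ closure (OO T), h u ∈ closure (OO T) := fun u hu =>
      map_mem_closure (LinearMap.continuous_of_finiteDimensional h.toLinearMap) hu hO
    let Y : Set (Fin d → ℝ) := {w | 0 < f (h w) ∧
      (f (h w))⁻¹ • h w ∈ convexHull ℝ (cmap T.Ω '' limitSet T.Ω T.Λ)}
    have hYadd : ∀ u ∈ Y, ∀ w ∈ Y, u + w ∈ Y := by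
      intro u hu w hw
      obtain ⟨s, t, hs, ht, hst, e⟩ := normalized_add hu.1 hw.1
      refine ⟨by rw [map_add, map_add]; exact add_pos hu.1 hw.1, ?_⟩
      rw [map_add, e]
      exact convex_convexHull ℝ _ hu.2 hw.2 hs.le ht.le hst
    have hYsmul : ∀ t : ℝ, 0 < t → ∀ u ∈ Y, t • u ∈ Y := by
      intro t ht u hu
      refine ⟨by simpa using mul_pos ht hu.1, ?_⟩
      have := hu.2
      rw [map_smul, map_smul, smul_eq_mul, smul_smul, mul_inv, mul_comm t⁻¹, mul_assoc,
        inv_mul_cancel₀ ht.ne', mul_one]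
      exact this
    have hYc : Convex ℝ Y := by
      rw [convex_iff_forall_pos]
      intro u hu w hw s t hs ht _
      exact hYadd _ (hYsmul s hs u hu) _ (hYsmul t ht w hw)
    have hsub : cmap T.Ω '' limitSet T.Ω T.Λ ⊆ Y := by
      rintro _ ⟨l, hl, rfl⟩
      have hlΩ := limit_sub T hl
      have hr := rep_ne T hlΩ
      have h1 : cmap T.Ω l ∈ closure (OO T) := chartMap_mem_closure_lift _ hr hlΩ
      have h2 := hcO _ h1
      have h3 : cmap T.Ω l ≠ 0 := chartMap_ne _ _ hr
      have h4 : h (cmap T.Ω l) ≠ 0 := by simpa using h3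
      refine ⟨f_pos_closure T h2 h4, subset_convexHull _ _ ⟨pact g l, pact_limit T hg hl, ?_⟩⟩
      have e := hmk _ h3 h4
      have e2 : Projectivization.mk ℝ (cmap T.Ω l) h3 = l := mk_chartMap _ l hr
      rw [e2] at e
      rw [← e]
      exact chartMap_mk _ _ h4
    have := convexHull_min hsub hYc hu.2
    have h9 := hYsmul (f u) hu.1.1 _ this
    rw [smul_smul, mul_inv_cancel₀ hu.1.1.ne', one_smul] at h9
    exact h9.2

lemma core_inv {g} (hg : g ∈ T.Λ) {x : PSpace d} (hx : x ∈ coreC T.Ω T.Λ) :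
    pact g x ∈ coreC T.Ω T.Λ := by
  obtain ⟨h, -, h2, c, hc, h3⟩ := exists_lift T hg
  have hr := rep_ne' T _ (core_sub T hx)
  have h1 : chartMap (chartOf T.Ω) x ∈ DD T := by
    refine ⟨by rw [f_chartMap _ _ hr]; exact one_pos, chartMap_ne _ _ hr, ?_⟩
    rwa [mk_chartMap _ _ hr]
  obtain ⟨_, h5, h6⟩ := h2 _ h1
  have h7 := chartMap_ne _ _ hr
  have h8 : g (chartMap (chartOf T.Ω) x) ≠ 0 := by simpa using h7
  rw [mk_congr (h3 _) h5 (smul_ne_zero hc h8), mk_smul_eq h8 hc, ← pact_mk g _ h7 h8,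
    mk_chartMap _ _ hr] at h6
  exact h6

lemma lift_compact_closed {K : Set (PSpace d)} (hK : IsCompact K) (hKΩ : K ⊆ T.Ω)
    {z : Fin d → ℝ} (hz : z ∈ closure (lift (chartOf T.Ω) K)) (hz0 : 0 < chartOf T.Ω z) :
    z ∈ lift (chartOf T.Ω) K := by
  have hr : ∀ x ∈ K, chartOf T.Ω x.rep ≠ 0 := fun x hx => rep_ne' T x (hKΩ hx)
  have hc := (hK.image_of_continuousOn (chartMap_continuousOn _ hr)).isClosed
  have fc : Continuous (chartOf T.Ω) := LinearMap.continuous_of_finiteDimensional _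
  rw [mem_lift_iff _ hr]
  refine ⟨hz0, ?_⟩
  have hcont : ContinuousAt (fun w => (chartOf T.Ω w)⁻¹ • w) z :=
    (fc.continuousAt.inv₀ hz0.ne').smul continuousAt_id
  have := hcont.continuousWithinAt.mem_closure hz (t := chartMap (chartOf T.Ω) '' K)
    (fun w hw => ((mem_lift_iff _ hr w).mp hw).2)
  rwa [hc.closure_eq] at this

lemma DD_closed {z : Fin d → ℝ} (hz : z ∈ closure (DD T)) (hzO : z ∈ OO T) : z ∈ DD T := by
  obtain ⟨K, hKC, hK, hcov⟩ := T.cocompact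
  have hO : IsOpen (OO T) := lift_isOpen _ T.isOpen_Ω
  obtain ⟨N, hN, hNO, hNc⟩ := local_compact_nhds (hO.mem_nhds hzO)
  let N' : Set (PSpace d) := {x | ∃ u ∈ N, ∃ h : u ≠ 0, x = Projectivization.mk ℝ u h}
  have hN' : IsCompact N' := isCompact_proj hNc (fun h => (hNO h).2.1 rfl)
  have hN'Ω : N' ⊆ T.Ω := by
    rintro _ ⟨u, hu, h, rfl⟩
    exact (hNO hu).2.2
  have hfin := T.discrete_Λ (K ∪ N') (union_subset (hKC.trans (core_sub T)) hN'Ω) (hK.union hN')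
  set F := {g : (Fin d → ℝ) ≃ₗ[ℝ] (Fin d → ℝ) | g ∈ T.Λ ∧
    (pact g '' (K ∪ N') ∩ (K ∪ N')).Nonempty} with hF
  have hz2 : z ∈ closure (DD T ∩ N) := by
    rw [mem_closure_iff_nhds] at hz ⊢
    intro t ht
    obtain ⟨w, ⟨h1, h2⟩, h3⟩ := hz _ (inter_mem ht hN)
    exact ⟨w, h1, h3, h2⟩
  have hsub : DD T ∩ N ⊆ ⋃ g ∈ F, lift (chartOf T.Ω) (pact g '' K) := by
    rintro w ⟨⟨h1, h2, h3⟩, h4⟩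
    have := hcov h3
    simp only [mem_iUnion] at this
    obtain ⟨g, hg, hgK⟩ := this
    simp only [mem_iUnion]
    refine ⟨g, ⟨hg, Projectivization.mk ℝ w h2, image_mono subset_union_left hgK,
      Or.inr ⟨w, h4, h2, rfl⟩⟩, h1, h2, hgK⟩
  have hz3 := closure_mono hsub hz2
  rw [hfin.closure_biUnion] at hz3
  simp only [mem_iUnion] at hz3
  obtain ⟨g, hg, hz4⟩ := hz3
  have hsubC : pact g '' K ⊆ coreC T.Ω T.Λ := by
    rintro _ ⟨k, hk, rfl⟩
    exact core_inv T hg.1 (hKC hk)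
  have := lift_compact_closed T (hK.image (pact_continuous g)) (hsubC.trans (core_sub T)) hz4 hzO.1
  exact lift_mono _ hsubC this

lemma exists_G : ∃ K : Set (Fin d → ℝ), IsCompact K ∧ K ⊆ OO T ∧ ∀ p ∈ DD T,
    ∃ h : (Fin d → ℝ) ≃ₗ[ℝ] (Fin d → ℝ), (∀ u, h u ∈ OO T ↔ u ∈ OO T) ∧
      (∀ u ∈ DD T, h u ∈ DD T) ∧ h p ∈ K := by
  obtain ⟨K, hKC, hK, hcov⟩ := T.cocompact
  have hKΩ := hKC.trans (core_sub T)
  have hr : ∀ x ∈ K, chartOf T.Ω x.rep ≠ 0 := fun x hx => rep_ne' T x (hKΩ hx)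
  refine ⟨chartMap (chartOf T.Ω) '' K, hK.image_of_continuousOn (chartMap_continuousOn _ hr),
    ?_, ?_⟩
  · rintro _ ⟨x, hx, rfl⟩
    refine ⟨by rw [f_chartMap _ _ (hr x hx)]; exact one_pos, chartMap_ne _ _ (hr x hx), ?_⟩
    rw [mk_chartMap _ _ (hr x hx)]
    exact hKΩ hx
  · rintro p hp
    obtain ⟨h1, h2, h3⟩ := hp
    have := hcov h3
    simp only [mem_iUnion] at this
    obtain ⟨g, hg, k, hk, hgk⟩ := this
    obtain ⟨h, hO, hD, c, hc, hh⟩ := exists_lift T (T.Λ.inv_mem hg)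
    have hpO : h p ∈ OO T := (hO p).mpr (DD_sub T ⟨h1, h2, h3⟩)
    have hpos := hpO.1
    have hk' : Projectivization.mk ℝ (h p) hpO.2.1 = k := by
      have h8 : g⁻¹ p ≠ 0 := by simpa using h2
      rw [mk_congr (hh p) _ (smul_ne_zero hc h8), mk_smul_eq h8 hc, ← pact_mk _ _ h2 h8, ← hgk,
        pact_inv]
    have hi := inv_pos.mpr hpos
    refine ⟨h.trans (LinearEquiv.smulOfNeZero ℝ _ _ hi.ne'), fun u => ?_, fun u hu => ?_, ?_⟩
    · change (chartOf T.Ω (h p))⁻¹ • h u ∈ OO T ↔ _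
      rw [← hO u]
      constructor
      · intro hu
        have := OO_smul T _ hpos _ hu
        rwa [smul_smul, mul_inv_cancel₀ hpos.ne', one_smul] at this
      · exact OO_smul T _ hi _
    · exact DD_smul T _ hi _ (hD u hu)
    · exact ⟨k, hk, by rw [← hk', chartMap_mk]; rfl⟩
end CC

section FF
variable (T : CCSetup d)

lemma K_smul' {t : ℝ} (ht : 0 < t) {u : Fin d → ℝ} (hu : u ∈ closure (OO T)) :
    t • u ∈ closure (OO T) :=
  LSet.closure_smul (OO_smul T) ht hu

lemma K_comb {s t : ℝ} (hs : 0 < s) (ht : 0 < t) {u w : Fin d → ℝ} (hu : u ∈ closure (OO T))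
    (hw : w ∈ closure (OO T)) : s • u + t • w ∈ closure (OO T) :=
  OO_nonzero_closure_add T (K_smul' T hs hu) (K_smul' T ht hw)

lemma f_nonneg_closure {u : Fin d → ℝ} (hu : u ∈ closure (OO T)) : 0 ≤ chartOf T.Ω u := by
  by_cases h : u = 0
  · simp [h]
  · exact (f_pos_closure T hu h).le

/-- vector description of the open face -/
def FV (x : Fin d → ℝ) : Set (Fin d → ℝ) :=
  {u | u ∈ closure (OO T) ∧ u ≠ 0 ∧ (∃ M : ℝ, 0 < M ∧ M • x - u ∈ closure (OO T)) ∧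
    ∃ M : ℝ, 0 < M ∧ M • u - x ∈ closure (OO T)}

lemma openSeg_norm {f : (Fin d → ℝ) →ₗ[ℝ] ℝ} {p q z : Fin d → ℝ} {α β : ℝ} (hp : 0 < f p)
    (hq : 0 < f q) (hα : 0 < α) (hβ : 0 < β) (hz : z = α • p + β • q) :
    (f z)⁻¹ • z ∈ openSegment ℝ ((f p)⁻¹ • p) ((f q)⁻¹ • q) := by
  have hp' : 0 < f (α • p) := by simpa using mul_pos hα hp
  have hq' : 0 < f (β • q) := by simpa using mul_pos hβ hq
  obtain ⟨s, t, hs, ht, hst, e⟩ := normalized_add hp' hq'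
  refine ⟨s, t, hs, ht, hst, ?_⟩
  rw [hz, e, map_smul, map_smul]
  simp only [smul_eq_mul]
  match_scalars <;> field_simp

lemma cmap_mem_K {y : PSpace d} (hy : y ∈ closure T.Ω) : cmap T.Ω y ∈ closure (OO T) :=
  chartMap_mem_closure_lift _ (rep_ne T hy) hy

lemma mk_mem_face {x u : Fin d → ℝ} (hx : x ∈ closure (OO T)) (hx0 : x ≠ 0)
    (hu : u ∈ FV T x) : Projectivization.mk ℝ u hu.2.1 ∈ face T.Ω (Projectivization.mk ℝ x hx0) := by
  obtain ⟨hK, hu0, ⟨M, hM, hM1⟩, M', hM', hM1'⟩ := hu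
  have ha : (M + 1) • x - u ∈ closure (OO T) := by
    have := OO_nonzero_closure_add T hM1 hx
    convert this using 1; module
  have hb : (M' + 1) • u - x ∈ closure (OO T) := by
    have := OO_nonzero_closure_add T hM1' hK
    convert this using 1; module
  have fx := f_pos_closure T hx hx0
  have fu := f_pos_closure T hK hu0
  have fa : 0 < chartOf T.Ω ((M + 1) • x - u) := by
    have h1 := f_nonneg_closure T hM1
    simp only [map_sub, map_smul, smul_eq_mul] at h1 ⊢
    linarith
  have fb : 0 < chartOf T.Ω ((M' + 1) • u - x) := by
    have h1 := f_nonneg_closure T hM1'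
    simp only [map_sub, map_smul, smul_eq_mul] at h1 ⊢
    linarith
  obtain ⟨D, hD⟩ : ∃ D : ℝ, D = (M + 1) * (M' + 1) - 1 := ⟨_, rfl⟩
  have hdet : 0 < D := by rw [hD]; nlinarith
  refine Or.inr ⟨mk_mem_closure _ hK _, Projectivization.mk ℝ _ (ne_of_f fa),
    mk_mem_closure _ ha _, Projectivization.mk ℝ _ (ne_of_f fb), mk_mem_closure _ hb _,
    ⟨mk_mem_closure _ hx _, ?_⟩, ⟨mk_mem_closure _ hK _, ?_⟩⟩
  · simp only [cmap, chartMap_mk]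
    refine openSeg_norm fa fb (α := (M' + 1) / D)
      (β := 1 / D) (by positivity) (by positivity) ?_
    match_scalars <;> field_simp <;> linarith
  · simp only [cmap, chartMap_mk]
    refine openSeg_norm fa fb (α := 1 / D)
      (β := (M + 1) / D) (by positivity) (by positivity) ?_
    match_scalars <;> field_simp <;> linarith

lemma mem_face {x : Fin d → ℝ} (hx : x ∈ closure (OO T)) (hx0 : x ≠ 0) {y : PSpace d}
    (hy : y ∈ face T.Ω (Projectivization.mk ℝ x hx0)) :
    y ∈ closure T.Ω ∧ cmap T.Ω y ∈ FV T x := by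
  have fx := f_pos_closure T hx hx0
  rcases hy with rfl | ⟨hy, a, ha, b, hb, ⟨-, h1⟩, -, h2⟩
  · refine ⟨mk_mem_closure _ hx _, ?_⟩
    rw [cmap, chartMap_mk]
    have fi := inv_pos.mpr fx
    refine ⟨K_smul' T fi hx, smul_ne_zero fi.ne' hx0, ⟨2 * (chartOf T.Ω x)⁻¹, by positivity, ?_⟩,
      2 * (chartOf T.Ω x), by positivity, ?_⟩
    · convert K_smul' T fi hx using 1; module
    · convert hx using 1
      match_scalars; field_simp; norm_num
  · refine ⟨hy, cmap_mem_K T hy, chartMap_ne _ _ (rep_ne T hy), ?_⟩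
    have hA := cmap_mem_K T ha
    have hB := cmap_mem_K T hb
    rw [cmap, chartMap_mk] at h1
    obtain ⟨s, t, hs, ht, -, e⟩ := h1
    obtain ⟨s', t', hs', ht', -, e'⟩ := h2
    change _ = cmap T.Ω y at e'
    change s • cmap T.Ω a + t • cmap T.Ω b = _ at e
    have ex : x = (chartOf T.Ω x) • (s • cmap T.Ω a + t • cmap T.Ω b) := by
      rw [e, smul_smul, mul_inv_cancel₀ fx.ne', one_smul]
    rw [← e']
    set A := cmap T.Ω a
    set B := cmap T.Ω b
    set φ := chartOf T.Ω x
    refine ⟨⟨(s' / s + t' / t) / φ, by positivity, ?_⟩, φ * (s / s' + t / t'), by positivity, ?_⟩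
    · have := K_comb T (s := t' / t * s) (t := s' / s * t) (by positivity) (by positivity) hA hB
      convert this using 1
      rw [ex]
      match_scalars <;> field_simp <;> ring
    · have := K_comb T (s := φ * (t / t' * s')) (t := φ * (s / s' * t')) (by positivity)
        (by positivity) hA hB
      convert this using 1
      rw [ex]
      match_scalars <;> field_simp <;> ring

lemma face_pc {x : Fin d → ℝ} (hx : x ∈ closure (OO T)) (hx0 : x ≠ 0) :
    IsProperlyConvex (face T.Ω (Projectivization.mk ℝ x hx0)) := by
  have hsub : face T.Ω (Projectivization.mk ℝ x hx0) ⊆ closure T.Ω :=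
    fun y hy => (mem_face T hx hx0 hy).1
  refine ⟨chartOf T.Ω, fun y hy => rep_ne T (closure_minimal hsub isClosed_closure hy), ?_, ?_⟩
  · rw [convex_iff_forall_pos]
    rintro _ ⟨y₁, h₁, rfl⟩ _ ⟨y₂, h₂, rfl⟩ s t hs ht hst
    obtain ⟨c₁, k₁, n₁, ⟨M₁, hM₁, m₁⟩, N₁, hN₁, l₁⟩ := mem_face T hx hx0 h₁
    obtain ⟨c₂, k₂, n₂, ⟨M₂, hM₂, m₂⟩, N₂, hN₂, l₂⟩ := mem_face T hx hx0 h₂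
    have e₁ : chartOf T.Ω (cmap T.Ω y₁) = 1 := f_chartMap _ _ (rep_ne T c₁)
    have e₂ : chartOf T.Ω (cmap T.Ω y₂) = 1 := f_chartMap _ _ (rep_ne T c₂)
    change s • cmap T.Ω y₁ + t • cmap T.Ω y₂ ∈ _
    set A := cmap T.Ω y₁
    set B := cmap T.Ω y₂
    have e : chartOf T.Ω (s • A + t • B) = 1 := by
      simp [e₁, e₂, hst]
    have hF : s • A + t • B ∈ FV T x := by
      refine ⟨K_comb T hs ht k₁ k₂, ne_of_f (by rw [e]; exact one_pos),
        ⟨s * M₁ + t * M₂, by positivity, ?_⟩, N₁ + N₂, by positivity, ?_⟩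
      · convert K_comb T hs ht m₁ m₂ using 1; module
      · have h1 := K_comb T hs ht l₁ l₂
        have h2 := K_comb T (s := s * N₂) (t := t * N₁) (by positivity) (by positivity) k₁ k₂
        convert OO_nonzero_closure_add T h1 h2 using 1
        have : t = 1 - s := by linarith
        subst this
        module
    exact ⟨_, mk_mem_face T hx hx0 hF, by rw [chartMap_mk, e, inv_one, one_smul]⟩
  · obtain ⟨R, hR, h⟩ := OO_norm T
    have hc : IsClosed {u : Fin d → ℝ | ‖u‖ ≤ R * chartOf T.Ω u} :=
      isClosed_le continuous_norm
        (continuous_const.mul (LinearMap.continuous_of_finiteDimensional _))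
    rw [isBounded_iff_forall_norm_le]
    refine ⟨R, ?_⟩
    rintro _ ⟨y, hy, rfl⟩
    obtain ⟨c, k, -⟩ := mem_face T hx hx0 hy
    have h1 : ‖cmap T.Ω y‖ ≤ R * chartOf T.Ω (cmap T.Ω y) := (closure_minimal h hc) k
    have e₁ : chartOf T.Ω (cmap T.Ω y) = 1 := f_chartMap _ _ (rep_ne T c)
    rw [e₁, mul_one] at h1
    exact h1

lemma field_H (hdim : ∀ x ∈ closure T.Ω \ T.Ω, (face T.Ω x ∩ closure (coreC T.Ω T.Λ)).Nonempty →
      pdim (face T.Ω x) ≤ 1) : ∀ x ∈ closure (DD T), x ∉ OO T → x ≠ 0 →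
    ∀ u₁ ∈ closure (OO T), ∀ u₂ ∈ closure (OO T), ∀ u₃ ∈ closure (OO T), ∀ M : ℝ,
      M • x - u₁ ∈ closure (OO T) → M • x - u₂ ∈ closure (OO T) → M • x - u₃ ∈ closure (OO T) →
      ¬ LinearIndependent ℝ ![u₁, u₂, u₃] := by
  intro x hxD hxO hx0 u₁ hu₁ u₂ hu₂ u₃ hu₃ M hm₁ hm₂ hm₃ hli
  have hx := closure_mono (DD_sub T) hxD
  have fx := f_pos_closure T hx hx0
  have hd := hdim (Projectivization.mk ℝ x hx0)
    ⟨mk_mem_closure _ hx _, fun h => hxO ⟨fx, hx0, h⟩⟩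
    ⟨_, Or.inl rfl, mk_mem_closure _ hxD _⟩
  have hpc := face_pc T hx hx0
  set Fa := face T.Ω (Projectivization.mk ℝ x hx0) with hFa
  have hch : ∀ y ∈ Fa, chartOf Fa y.rep ≠ 0 := by
    have h : chartOf Fa = hpc.choose := by rw [chartOf, dif_pos hpc]
    rw [h]
    exact fun y hy => hpc.choose_spec.1 y (subset_closure hy)
  have hxF : Projectivization.mk ℝ x hx0 ∈ Fa := Or.inl rfl
  rw [pdim, pdimIn] at hd
  set V := (affineSpan ℝ (cmap Fa '' Fa)).direction with hV
  set c₀ := cmap Fa (Projectivization.mk ℝ x hx0) with hc₀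
  let W : Submodule ℝ (Fin d → ℝ) := Submodule.span ℝ {c₀} ⊔ V
  have hW : Module.finrank ℝ W ≤ 2 := by
    have h1 := Submodule.finrank_add_le_finrank_add_finrank (Submodule.span ℝ {c₀}) V
    have h2 : Module.finrank ℝ (Submodule.span ℝ {c₀}) ≤ 1 := by
      have := finrank_span_le_card (R := ℝ) ({c₀} : Set (Fin d → ℝ))
      simpa using this
    change Module.finrank ℝ (Submodule.span ℝ {c₀} ⊔ V : Submodule ℝ (Fin d → ℝ)) ≤ 2
    omega
  have hmem : ∀ u (hu : u ≠ 0), Projectivization.mk ℝ u hu ∈ Fa → u ∈ W := by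
    intro u hu h
    have h1 : cmap Fa (Projectivization.mk ℝ u hu) - c₀ ∈ V :=
      AffineSubspace.vsub_mem_direction (subset_affineSpan _ _ ⟨_, h, rfl⟩)
        (subset_affineSpan _ _ ⟨_, hxF, rfl⟩)
    have h2 : cmap Fa (Projectivization.mk ℝ u hu) ∈ W := by
      have := W.add_mem (le_sup_right (a := Submodule.span ℝ {c₀}) h1)
        (le_sup_left (b := V) (Submodule.mem_span_singleton_self c₀))
      simpa using this
    have h3 := hch _ h
    rw [f_rep_iff] at h3
    rw [cmap, chartMap_mk] at h2
    have := W.smul_mem (chartOf Fa u) h2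
    rwa [smul_smul, mul_inv_cancel₀ h3, one_smul] at this
  have hxW : x ∈ W := hmem x hx0 hxF
  have hall : ∀ u ∈ closure (OO T), M • x - u ∈ closure (OO T) → u ∈ W := by
    intro u hu hm
    have hF : x + u ∈ FV T x := by
      refine ⟨OO_nonzero_closure_add T hx hu, ne_of_f (f := chartOf T.Ω) ?_,
        ⟨|M| + 2, by positivity, ?_⟩, 1, one_pos, ?_⟩
      · rw [map_add]
        have := f_nonneg_closure T hu
        linarith
      · have h1 := K_smul' T (t := |M| - M + 1) (by have := le_abs_self M; linarith) hx
        convert OO_nonzero_closure_add T h1 hm using 1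
        module
      · convert hu using 1; module
    have h1 := hmem _ _ (mk_mem_face T hx hx0 hF)
    have := W.sub_mem h1 hxW
    simpa using this
  have hspan : Submodule.span ℝ (range ![u₁, u₂, u₃]) ≤ W := by
    rw [Submodule.span_le]
    rintro _ ⟨i, rfl⟩
    fin_cases i
    · exact hall _ hu₁ hm₁
    · exact hall _ hu₂ hm₂
    · exact hall _ hu₃ hm₃
  have h1 := finrank_span_eq_card hli
  have h2 := Submodule.finrank_mono hspan
  rw [h1] at h2
  simp at h2
  omega

end FF

/-- the linear data -/
def toLSet (T : CCSetup d)
    (hdim : ∀ x ∈ closure T.Ω \ T.Ω, (face T.Ω x ∩ closure (coreC T.Ω T.Λ)).Nonempty →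
      pdim (face T.Ω x) ≤ 1) : LSet d where
  O := OO T
  D := DD T
  f := chartOf T.Ω
  R := (OO_norm T).choose
  isOpen := lift_isOpen _ T.isOpen_Ω
  add_mem := OO_add T
  smul_mem := OO_smul T
  f_pos := fun _ hu => hu.1
  norm_le := (OO_norm T).choose_spec.2
  R_pos := (OO_norm T).choose_spec.1
  D_sub := DD_sub T
  D_add := DD_add T
  D_smul := DD_smul T
  H := field_H T hdim
  G := exists_G T

/-- combination of the first three basis vectors -/
def cb (x y z : ℝ) : Fin d → ℝ := fun i =>
  if (i : ℕ) = 0 then x else if (i : ℕ) = 1 then y else if (i : ℕ) = 2 then z else 0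

lemma cb_eq (x y z : ℝ) : (cb x y z : Fin d → ℝ) =
    x • cb 1 0 0 + y • cb 0 1 0 + z • cb 0 0 1 := by
  ext i
  simp only [cb, Pi.add_apply, Pi.smul_apply, smul_eq_mul]
  split_ifs <;> simp

lemma eq_cb (hd : 3 ≤ d) {w : Fin d → ℝ} (h : ∀ i : Fin d, 3 ≤ (i : ℕ) → w i = 0) :
    w = cb (w ⟨0, by omega⟩) (w ⟨1, by omega⟩) (w ⟨2, by omega⟩) := by
  ext i
  simp only [cb]
  split_ifs with h0 h1 h2
  · congr 1; ext; exact h0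
  · congr 1; ext; exact h1
  · congr 1; ext; exact h2
  · exact h i (by omega)

lemma cb_mem_cone {x y z : ℝ} (hx : 0 < x) (hy : 0 < y) (hz : 0 < z) :
    (cb x y z : Fin d → ℝ) ∈ simplexCone (d := d) 3 := by
  constructor
  · intro i hi
    simp only [cb]
    split_ifs
    · exact hx
    · exact hy
    · exact hz
    · omega
  · intro i hi
    simp only [cb]
    rw [if_neg (by omega), if_neg (by omega), if_neg (by omega)]

lemma cone_comb : ∀ u ∈ simplexCone (d := d) 3, ∀ w ∈ simplexCone (d := d) 3, ∀ s t : ℝ,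
    0 < s → 0 < t → s • u + t • w ∈ simplexCone (d := d) 3 := by
  intro u hu w hw s t hs ht
  constructor
  · intro i hi
    exact add_pos (mul_pos hs (hu.1 i hi)) (mul_pos ht (hw.1 i hi))
  · intro i hi
    simp [hu.2 i hi, hw.2 i hi]

lemma cone_ne (hd : 3 ≤ d) {w : Fin d → ℝ} (hw : w ∈ simplexCone (d := d) 3) : w ≠ 0 := by
  rintro rfl
  have := hw.1 ⟨0, by omega⟩ (by simp)
  simp at this

lemma closed_of_pe {S C : Set (PSpace d)} (h : IsProperlyEmbedded S C) {x : PSpace d}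
    (hx : x ∈ closure S) (hxC : x ∈ C) : x ∈ S := by
  obtain ⟨hs, hp⟩ := h
  have h1 := hp.isClosedMap.isClosed_range
  rw [Topology.IsInducing.subtypeVal.isClosed_iff] at h1
  obtain ⟨t, ht, e⟩ := h1
  have hSt : S ⊆ t := by
    intro y hy
    have : (⟨y, hs hy⟩ : C) ∈ (Subtype.val ⁻¹' t : Set C) := by
      rw [e]; exact ⟨⟨y, hy⟩, rfl⟩
    exact this
  have h2 : (⟨x, hxC⟩ : C) ∈ (Subtype.val ⁻¹' t : Set C) := closure_minimal hSt ht hx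
  rw [e] at h2
  obtain ⟨⟨y, hy⟩, e2⟩ := h2
  have : y = x := congrArg Subtype.val e2
  rwa [← this]

lemma simplex_data (T : CCSetup d)
    (hdim : ∀ x ∈ closure T.Ω \ T.Ω, (face T.Ω x ∩ closure (coreC T.Ω T.Λ)).Nonempty →
      pdim (face T.Ω x) ≤ 1)
    (S : Set (PSpace d)) (hS : IsSimplexOfDim 2 S) (hsub : S ⊆ coreC T.Ω T.Λ)
    (hpe : IsProperlyEmbedded S (coreC T.Ω T.Λ)) :
    ∃ v a b : Fin d → ℝ, (toLSet T hdim).Tri v a b ∧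
      S = {q | ∃ u ∈ LSet.coneSet v a b, ∃ h : u ≠ 0, q = Projectivization.mk ℝ u h} ∧
      ∀ x ∈ closure S \ S, ∃ r s t : ℝ, 0 ≤ r ∧ 0 ≤ s ∧ 0 ≤ t ∧ ¬ (0 < r ∧ 0 < s ∧ 0 < t) ∧
        chartMap (chartOf T.Ω) x = r • v + s • a + t • b := by
  obtain ⟨hd, g, hg⟩ := hS
  change 3 ≤ d at hd
  change S = {q : PSpace d | ∃ v ∈ simplexCone (d := d) 3, ∃ hv : v ≠ 0,
        q = Projectivization.mk ℝ (g v) (by simpa using hv)} at hg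
  have hgS : ∀ w ∈ simplexCone (d := d) 3, ∀ h : g w ≠ 0, Projectivization.mk ℝ (g w) h ∈ S := by
    intro w hw h
    rw [hg]
    exact ⟨w, hw, cone_ne hd hw, rfl⟩
  set f := chartOf T.Ω with hf
  obtain ⟨σ, hσ, hσp⟩ := exists_sign (X := simplexCone (d := d) 3) cone_comb
    (f.comp g.toLinearMap) (by
      intro w hw
      have h0 : g w ≠ 0 := by simpa using cone_ne hd hw
      have h1 := rep_ne' T _ (core_sub T (hsub (hgS w hw h0)))
      rw [f_rep_iff] at h1
      exact h1)
  obtain ⟨k, hk⟩ : ∃ k : (Fin d → ℝ) ≃ₗ[ℝ] (Fin d → ℝ), ∀ u, k u = σ • g u :=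
    ⟨g.trans (LinearEquiv.smulOfNeZero ℝ _ σ hσ), fun u => rfl⟩
  have kpos : ∀ w ∈ simplexCone (d := d) 3, 0 < f (k w) := by
    intro w hw
    rw [hk]
    simpa using hσp w hw
  have hkS : ∀ w ∈ simplexCone (d := d) 3, ∀ h : k w ≠ 0, Projectivization.mk ℝ (k w) h ∈ S := by
    intro w hw h
    have h0 : g w ≠ 0 := by simpa using cone_ne hd hw
    rw [mk_congr (hk w) h (smul_ne_zero hσ h0), mk_smul_eq h0 hσ]
    exact hgS w hw h0
  have hS' : ∀ q ∈ S, ∃ w ∈ simplexCone (d := d) 3, ∃ h : k w ≠ 0,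
      q = Projectivization.mk ℝ (k w) h := by
    intro q hq
    rw [hg] at hq
    obtain ⟨w, hw, hw0, rfl⟩ := hq
    have h0 : g w ≠ 0 := by simpa using cone_ne hd hw
    have h1 : k w ≠ 0 := by simpa using hw0
    refine ⟨w, hw, h1, ?_⟩
    rw [mk_congr (hk w) h1 (smul_ne_zero hσ h0), mk_smul_eq h0 hσ]
  have hcomb : ∀ x y z : ℝ, x • k (cb 1 0 0) + y • k (cb 0 1 0) + z • k (cb 0 0 1)
      = k (cb x y z) := by
    intro x y z
    rw [cb_eq x y z]
    simp only [map_add, map_smul]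
  have hlift : ∀ x y z : ℝ, 0 < x → 0 < y → 0 < z → k (cb x y z) ∈ lift f S := by
    intro x y z hx hy hz
    have h1 := kpos _ (cb_mem_cone hx hy hz)
    exact ⟨h1, ne_of_f h1, hkS _ (cb_mem_cone hx hy hz) _⟩
  have hDl : lift f S ⊆ DD T := lift_mono _ hsub
  have hpos : ∀ x y z : ℝ, 0 ≤ x → 0 ≤ y → 0 ≤ z → ∀ h : k (cb x y z) ≠ 0,
      Projectivization.mk ℝ (k (cb x y z)) h ∈ S → 0 < x ∧ 0 < y ∧ 0 < z := by
    intro x y z hx hy hz h hm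
    obtain ⟨w, hw, hw0, e⟩ := hS' _ hm
    rw [Projectivization.mk_eq_mk_iff'] at e
    obtain ⟨c, hc⟩ := e
    rw [← map_smul] at hc
    have hc := k.injective hc
    have e0 : c * w ⟨0, by omega⟩ = x := by simpa [cb] using congrFun hc ⟨0, by omega⟩
    have e1 : c * w ⟨1, by omega⟩ = y := by simpa [cb] using congrFun hc ⟨1, by omega⟩
    have e2 : c * w ⟨2, by omega⟩ = z := by simpa [cb] using congrFun hc ⟨2, by omega⟩
    have p0 := hw.1 ⟨0, by omega⟩ (by simp)
    have p1 := hw.1 ⟨1, by omega⟩ (by simp)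
    have p2 := hw.1 ⟨2, by omega⟩ (by simp)
    have hc0 : c ≠ 0 := by
      rintro rfl
      apply h
      rw [← hc]; simp
    have hcn : 0 ≤ c := by
      by_contra hn
      have := mul_neg_of_neg_of_pos (not_le.mp hn) p0
      linarith
    have hcp : 0 < c := lt_of_le_of_ne hcn hc0.symm
    rw [← e0, ← e1, ← e2]
    exact ⟨mul_pos hcp p0, mul_pos hcp p1, mul_pos hcp p2⟩
  have hcl : ∀ x y z : ℝ, 0 ≤ x → 0 ≤ y → 0 ≤ z → k (cb x y z) ∈ closure (lift f S) := by
    intro x y z hx hy hz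
    have hc : Continuous (fun ε : ℝ => k (cb x y z) + ε • k (cb 1 1 1)) := by fun_prop
    have h1 : Tendsto (fun ε : ℝ => k (cb x y z) + ε • k (cb 1 1 1)) (nhdsWithin 0 (Ioi 0))
        (nhds (k (cb x y z))) := by
      have := hc.tendsto 0
      simp only [zero_smul, add_zero] at this
      exact this.mono_left nhdsWithin_le_nhds
    refine mem_closure_of_tendsto h1 ?_
    filter_upwards [self_mem_nhdsWithin] with ε hε
    have hε : 0 < ε := hε
    have e : k (cb x y z) + ε • k (cb 1 1 1) = k (cb (x + ε) (y + ε) (z + ε)) := by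
      rw [← hcomb x y z, ← hcomb (x + ε) (y + ε) (z + ε), ← hcomb 1 1 1]; module
    rw [e]
    exact hlift _ _ _ (by linarith) (by linarith) (by linarith)
  have hedge : ∀ x y z : ℝ, 0 ≤ x → 0 ≤ y → 0 ≤ z → ¬ (0 < x ∧ 0 < y ∧ 0 < z) →
      k (cb x y z) ∉ OO T := by
    intro x y z hx hy hz hn hO
    have h1 := hcl x y z hx hy hz
    have h2 := DD_closed T (closure_mono hDl h1) hO
    exact hn (hpos x y z hx hy hz hO.2.1 (closed_of_pe hpe (mk_mem_closure f h1 hO.2.1) h2.2.2))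
  refine ⟨k (cb 1 0 0), k (cb 0 1 0), k (cb 0 0 1), ⟨?_, ?_, ?_, ?_, ?_⟩, ?_, ?_⟩
  · rw [Fintype.linearIndependent_iff]
    intro c hc
    simp only [Fin.sum_univ_three, Matrix.cons_val_zero, Matrix.cons_val_one, Matrix.cons_val] at hc
    rw [hcomb] at hc
    have hc : (cb (c 0) (c 1) (c 2) : Fin d → ℝ) = 0 := by simpa using hc
    have e0 : c 0 = 0 := by simpa [cb] using congrFun hc ⟨0, by omega⟩
    have e1 : c 1 = 0 := by simpa [cb] using congrFun hc ⟨1, by omega⟩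
    have e2 : c 2 = 0 := by simpa [cb] using congrFun hc ⟨2, by omega⟩
    intro i
    fin_cases i
    · exact e0
    · exact e1
    · exact e2
  · intro x y z hx hy hz
    rw [hcomb]
    exact hDl (hlift x y z hx hy hz)
  · have h := hcomb 1 1 0
    simp only [one_smul, zero_smul, add_zero] at h
    rw [h]
    exact hedge _ _ _ (by simp) (by simp) (by simp) (by simp)
  · have h := hcomb 1 0 1
    simp only [one_smul, zero_smul, add_zero] at h
    rw [h]
    exact hedge _ _ _ (by simp) (by simp) (by simp) (by simp)
  · have h := hcomb 0 1 1
    simp only [one_smul, zero_smul, zero_add] at h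
    rw [h]
    exact hedge _ _ _ (by simp) (by simp) (by simp) (by simp)
  · ext q
    constructor
    · intro hq
      obtain ⟨w, hw, h, rfl⟩ := hS' q hq
      refine ⟨k w, ⟨_, _, _, hw.1 ⟨0, by omega⟩ (by simp), hw.1 ⟨1, by omega⟩ (by simp),
        hw.1 ⟨2, by omega⟩ (by simp), ?_⟩, h, rfl⟩
      rw [hcomb, ← eq_cb hd hw.2]
    · rintro ⟨_, ⟨x, y, z, hx, hy, hz, rfl⟩, h, rfl⟩
      rw [mk_congr (hcomb x y z) h (by rwa [← hcomb])]
      exact hkS _ (cb_mem_cone hx hy hz) _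
  · rintro x ⟨hx, hxS⟩
    have hxΩ : x ∈ closure T.Ω := closure_mono (hsub.trans (core_sub T)) hx
    have hr := rep_ne T hxΩ
    have h1 : chartMap f x ∈ closure (lift f S) := chartMap_mem_closure_lift _ hr hx
    let P : Set (Fin d → ℝ) := {u | (∀ i : Fin d, (i : ℕ) < 3 → 0 ≤ k.symm u i) ∧
      ∀ i : Fin d, 3 ≤ (i : ℕ) → k.symm u i = 0}
    have kc : Continuous k.symm := LinearMap.continuous_of_finiteDimensional k.symm.toLinearMap
    have hP : IsClosed P := by
      have e : P = (⋂ i : Fin d, ⋂ _ : (i : ℕ) < 3, {u | 0 ≤ k.symm u i}) ∩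
          ⋂ i : Fin d, ⋂ _ : 3 ≤ (i : ℕ), {u | k.symm u i = 0} := by
        ext u; simp [P]
      rw [e]
      refine IsClosed.inter (isClosed_iInter fun i => isClosed_iInter fun _ => ?_)
        (isClosed_iInter fun i => isClosed_iInter fun _ => ?_)
      · exact isClosed_le continuous_const ((continuous_apply i).comp kc)
      · exact isClosed_eq ((continuous_apply i).comp kc) continuous_const
    have hsubP : lift f S ⊆ P := by
      rintro u ⟨hu, hu0, hm⟩
      obtain ⟨w, hw, hw0, e⟩ := hS' _ hm
      rw [Projectivization.mk_eq_mk_iff'] at e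
      obtain ⟨c, rfl⟩ := e
      have hcp : 0 < c := by
        have h2 := kpos w hw
        rw [map_smul, smul_eq_mul] at hu
        exact pos_of_mul_pos_left hu h2.le
      constructor
      · intro i hi
        simpa using mul_nonneg hcp.le (hw.1 i hi).le
      · intro i hi
        simp [hw.2 i hi]
    have h2 := closure_minimal hsubP hP h1
    set w := k.symm (chartMap f x) with hw
    have e : chartMap f x = k (cb (w ⟨0, by omega⟩) (w ⟨1, by omega⟩) (w ⟨2, by omega⟩)) := by
      rw [← eq_cb hd h2.2]; simp
    have q0 := h2.1 ⟨0, by omega⟩ (by simp)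
    have q1 := h2.1 ⟨1, by omega⟩ (by simp)
    have q2 := h2.1 ⟨2, by omega⟩ (by simp)
    refine ⟨_, _, _, q0, q1, q2, ?_, by rw [hcomb]; exact e⟩
    rintro ⟨p0, p1, p2⟩
    apply hxS
    have h3 := chartMap_ne f x hr
    rw [← mk_chartMap f x hr, mk_congr e h3 (by rwa [← e])]
    exact hkS _ (cb_mem_cone p0 p1 p2) _

/-- Lemma 6.3: under the assumption that all boundary faces meeting
`closure C_Ω(Λ)` have dimension at most one, distinct properly embedded two-dimensional
simplices in `C_Ω(Λ)` have disjoint boundaries. -/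
theorem distinct_simplices_disjoint_boundaries {d : ℕ} (T : CCSetup d)
    (hdim : ∀ x ∈ closure T.Ω \ T.Ω, (face T.Ω x ∩ closure (coreC T.Ω T.Λ)).Nonempty →
      pdim (face T.Ω x) ≤ 1)
    (S₁ S₂ : Set (PSpace d))
    (hS₁ : IsSimplexOfDim 2 S₁) (hS₁sub : S₁ ⊆ coreC T.Ω T.Λ)
    (hS₁pe : IsProperlyEmbedded S₁ (coreC T.Ω T.Λ))
    (hS₂ : IsSimplexOfDim 2 S₂) (hS₂sub : S₂ ⊆ coreC T.Ω T.Λ)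
    (hS₂pe : IsProperlyEmbedded S₂ (coreC T.Ω T.Λ))
    (hne : S₁ ≠ S₂) :
    (closure S₁ \ S₁) ∩ (closure S₂ \ S₂) = ∅ := by
  rw [Set.eq_empty_iff_forall_notMem]
  rintro x ⟨hx₁, hx₂⟩
  obtain ⟨v, a, b, T₁, e₁, h₁⟩ := simplex_data T hdim S₁ hS₁ hS₁sub hS₁pe
  obtain ⟨v', a', b', T₂, e₂, h₂⟩ := simplex_data T hdim S₂ hS₂ hS₂sub hS₂pe
  obtain ⟨r, s, t, hr, hs, ht, hn, h⟩ := h₁ x hx₁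
  obtain ⟨r', s', t', hr', hs', ht', hn', h'⟩ := h₂ x hx₂
  have hxΩ : x ∈ closure T.Ω := closure_mono (hS₁sub.trans (core_sub T)) hx₁.1
  have := LSet.linear_main (L := toLSet T hdim) T₁ T₂ hr hs ht hr' hs' ht'
    (chartMap_ne _ x (rep_ne T hxΩ)) h h' hn hn'
  apply hne
  rw [e₁, e₂, this]

end Paper
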